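/- arXiv:1805.00075 — 2 statements merged into one kernel-verified Lean document; each statement's English description precedes it below -/
import Mathlib

section
/- For every integer k ≥ 0 and every τ ∈ ℝ, the set of limit points, in the extended real line ℝ ∪ {+∞,−∞}, of the sequence ((σ_n(τ) − τ)·n^{k+1})_{n≥1} is equal to: {0, c_0, −c_0} if k = 0 and τ ∉ X_1; {c_0/2, −c_0/2} if k = 0 and τ ∈ X_1; {0, c_k, −c_k, +∞, −∞} if k ≥ 1 and τ ∉ Y_{k+1}; {c_k/2, −c_k/2, +∞, −∞} if k ≥ 1 and τ ∈ X_{k+1}; and {+∞, −∞} if k ≥ 1 and τ ∈ Y_k. -/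
open Filter

/-- Greedy partial sums: `gSigma τ n = σ_n(τ)`. -/
noncomputable def gSigma (τ : ℝ) : ℕ → ℝ
  | 0 => 0
  | n + 1 => gSigma τ n + (if gSigma τ n ≤ τ then (1 : ℝ) else -1) / (n + 1)

/-- Greedy signs: for `n ≥ 1`, `gSign τ n = s_n(τ)`. -/
noncomputable def gSign (τ : ℝ) (n : ℕ) : ℝ :=
  if gSigma τ (n - 1) ≤ τ then 1 else -1

/-- Thue–Morse signs: `tmSign n = ε_n`. -/
noncomputable def tmSign (n : ℕ) : ℝ := (-1 : ℝ) ^ (Nat.digits 2 n).sum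

/-- `fPer k` is the `2^k`-periodic function with `fPer k n = ε_n` for `0 ≤ n < 2^k`. -/
noncomputable def fPer (k n : ℕ) : ℝ := tmSign (n % 2 ^ k)

/-- The exceptional set `X_k`. -/
def Xset (k : ℕ) : Set ℝ :=
  {τ | ∃ N m : ℕ, m < 2 ^ k ∧ ∀ n : ℕ, 1 ≤ n → N ≤ n → gSign τ n = fPer k (n + m)}

/-- `Y_k = ⋃_{1 ≤ h ≤ k} X_h`. -/
def Yset (k : ℕ) : Set ℝ := ⋃ h ∈ Finset.Icc 1 k, Xset h

/-- `cConst k = c_k = 2^{k(k-1)/2} k!`. -/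
noncomputable def cConst (k : ℕ) : ℝ := 2 ^ (k * (k - 1) / 2) * Nat.factorial k

/-- The set of limit points, in the extended real line, of the sequence
`((σ_n(τ) - τ)·n^{k+1})_{n ≥ 1}`. -/
def limitPts (k : ℕ) (τ : ℝ) : Set EReal :=
  {L | MapClusterPt L atTop
    (fun n : ℕ => (((gSigma τ n - τ) * (n : ℝ) ^ (k + 1) : ℝ) : EReal))}

namespace GreedyTM

open Topology Finset

noncomputable def gg (x : ℝ) : ℝ := if x ≤ 0 then 1 else -1

lemma gg_cases (x : ℝ) : gg x = 1 ∨ gg x = -1 := by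
  unfold gg; split_ifs <;> simp

lemma abs_gg_add (x a : ℝ) : |x + gg x * a| = |(|x| - a)| := by
  unfold gg
  split_ifs with h
  · rw [abs_of_nonpos h, ← abs_neg]; congr 1; ring
  · rw [abs_of_pos (not_le.1 h)]; congr 1; ring

lemma gg_flip {x a : ℝ} (h : |x| < a) : gg (x + gg x * a) = - gg x := by
  obtain ⟨h1, h2⟩ := abs_lt.1 h
  by_cases hx : x ≤ 0
  · have : gg x = 1 := by simp [gg, hx]
    rw [this]
    have : ¬ (x + 1 * a ≤ 0) := by linarith
    simp only [gg, this, if_false]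
  · have : gg x = -1 := by simp [gg, hx]
    rw [this]
    have : (x + -1 * a ≤ 0) := by linarith
    simp only [gg, this, if_true]; norm_num

lemma gg_ne {x a : ℝ} (h : gg (x + gg x * a) ≠ gg x) : |x| ≤ a := by
  by_cases hx : x ≤ 0
  · have h1 : gg x = 1 := by simp [gg, hx]
    rw [h1] at h
    have : ¬ (x + 1 * a ≤ 0) := by
      intro h2; apply h; simp only [gg, h2, if_true]
    rw [abs_of_nonpos hx]; linarith
  · have h1 : gg x = -1 := by simp [gg, hx]
    rw [h1] at h
    have : (x + -1 * a ≤ 0) := by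
      by_contra h2; apply h; simp only [gg, h2, if_false]
    rw [abs_of_pos (not_le.1 hx)]; linarith

lemma gg_one {x : ℝ} (h : gg x = 1) : x = -|x| := by
  unfold gg at h
  split_ifs at h with h1
  · rw [abs_of_nonpos h1]; ring
  · norm_num at h

lemma gg_neg_one {x : ℝ} (h : gg x = -1) : x = |x| := by
  unfold gg at h
  split_ifs at h with h1
  · norm_num at h
  · rw [abs_of_pos (not_le.1 h1)]

noncomputable def DB (m n : ℕ) : ℝ :=
  m.factorial * ∏ i ∈ range (m+1), 1 / ((n:ℝ) + i + 1)

noncomputable def DD : ℕ → ℕ → ℕ → ℝ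
  | 0, m, n => DB m n
  | k+1, m, n => ∑ i ∈ range (2^k), DD k (m+1) (n+i)

lemma DB_diff (m n : ℕ) : DB m n - DB m (n+1) = DB (m+1) n := by
  unfold DB
  have h1 : ∏ i ∈ range (m+1+1), 1 / ((n:ℝ) + i + 1)
      = (∏ i ∈ range m, 1 / ((n:ℝ) + i + 2)) * (1/((n:ℝ)+1)) * (1/((n:ℝ)+m+2)) := by
    rw [prod_range_succ, prod_range_succ']
    push_cast
    congr 1
    · congr 1
      · apply prod_congr rfl; intros; congr 1; ring
      · congr 1; ring
    · congr 1; ring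
  have h2 : ∏ i ∈ range (m+1), 1 / ((n:ℝ) + i + 1)
      = (∏ i ∈ range m, 1 / ((n:ℝ) + i + 2)) * (1/((n:ℝ)+1)) := by
    rw [prod_range_succ']
    push_cast
    congr 1
    · apply prod_congr rfl; intros; congr 1; ring
    · congr 1; ring
  have h3 : ∏ i ∈ range (m+1), 1 / (((n+1:ℕ):ℝ) + i + 1)
      = (∏ i ∈ range m, 1 / ((n:ℝ) + i + 2)) * (1/((n:ℝ)+m+2)) := by
    rw [prod_range_succ]
    push_cast
    congr 1
    · apply prod_congr rfl; intros; congr 1; ring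
    · congr 1; ring
  rw [h1, h2, h3, Nat.factorial_succ]
  generalize (∏ i ∈ range m, 1 / ((n:ℝ) + i + 2)) = P
  push_cast
  have e1 : (n:ℝ)+1 ≠ 0 := by positivity
  have e2 : (n:ℝ)+m+2 ≠ 0 := by positivity
  field_simp
  ring

lemma DB_pos (m n : ℕ) : 0 < DB m n := by
  unfold DB
  apply mul_pos (by positivity)
  apply prod_pos; intros; positivity

lemma DD_pos (k : ℕ) : ∀ m n, 0 < DD k m n := by
  induction k with
  | zero => intro m n; rw [DD]; exact DB_pos m n
  | succ k ih =>
    intro m n; rw [DD]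
    exact sum_pos (fun i _ => ih _ _) (by simp)

lemma DD_diff (k : ℕ) : ∀ m n, DD k m n - DD k m (n+1) = DD k (m+1) n := by
  induction k with
  | zero => intro m n; simp only [DD]; exact DB_diff m n
  | succ k ih =>
    intro m n; simp only [DD]
    rw [← sum_sub_distrib]
    apply sum_congr rfl
    intro i _
    rw [show n + 1 + i = n + i + 1 by ring, ih]

lemma DD_succ (k m n : ℕ) : DD (k+1) m n = DD k m n - DD k m (n + 2^k) := by
  rw [DD]
  have := sum_range_sub' (fun i => DD k m (n+i)) (2^k)
  simp only [add_zero] at this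
  rw [← this]
  apply sum_congr rfl
  intro i _
  rw [← DD_diff]; rfl

lemma ratio_tendsto (i e : ℕ) :
    Tendsto (fun n : ℕ => ((n:ℝ) / ((n + i : ℕ) : ℝ))^e) atTop (𝓝 1) := by
  have h : Tendsto (fun n : ℕ => ((n:ℝ) / ((n:ℝ) + i))) atTop (𝓝 1) :=
    tendsto_natCast_div_add_atTop (i:ℝ)
  have := h.pow e
  simpa using this

lemma shift_tendsto {f : ℕ → ℝ} {e : ℕ} {L : ℝ} (i : ℕ)
    (h : Tendsto (fun n : ℕ => f n * (n:ℝ)^e) atTop (𝓝 L)) :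
    Tendsto (fun n : ℕ => f (n+i) * (n:ℝ)^e) atTop (𝓝 L) := by
  have h1 := (h.comp (tendsto_add_atTop_nat i)).mul (ratio_tendsto i e)
  rw [mul_one] at h1
  refine h1.congr' ?_
  filter_upwards [eventually_gt_atTop 0] with n hn
  have : ((n + i : ℕ) : ℝ) ≠ 0 := by positivity
  simp only [Function.comp]
  rw [mul_assoc, ← mul_pow, mul_div_cancel₀ _ this]

lemma DB_tendsto (m : ℕ) :
    Tendsto (fun n : ℕ => DB m n * (n:ℝ)^(m+1)) atTop (𝓝 (m.factorial)) := by
  have h : Tendsto (fun n : ℕ => (m.factorial : ℝ) * ∏ i ∈ range (m+1),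
      ((n:ℝ) / ((n:ℝ) + ((i:ℝ) + 1)))) atTop (𝓝 (m.factorial * ∏ i ∈ range (m+1), (1:ℝ))) := by
    apply Tendsto.const_mul
    apply tendsto_finsetProd
    intro i _
    exact tendsto_natCast_div_add_atTop _
  simp only [prod_const_one, mul_one] at h
  refine h.congr ?_
  intro n
  unfold DB
  rw [mul_assoc]
  congr 1
  have : (n:ℝ)^(m+1) = ∏ i ∈ range (m+1), (n:ℝ) := by simp
  rw [this, ← prod_mul_distrib]
  apply prod_congr rfl
  intro i _
  rw [add_assoc]; ring

lemma DD_tendsto (k : ℕ) : ∀ m, Tendsto (fun n : ℕ => DD k m n * (n:ℝ)^(k+m+1)) atTop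
    (𝓝 (2^(k*(k-1)/2) * (k+m).factorial)) := by
  induction k with
  | zero => intro m; simpa [DD] using DB_tendsto m
  | succ k ih =>
    intro m
    have h : Tendsto (fun n : ℕ => ∑ i ∈ range (2^k), DD k (m+1) (n+i) * (n:ℝ)^(k+(m+1)+1)) atTop
      (𝓝 (∑ i ∈ range (2^k), (2^(k*(k-1)/2) * (k+(m+1)).factorial : ℝ))) :=
      tendsto_finsetSum _ (fun i _ => shift_tendsto i (ih (m+1)))
    have e : k + 1 + m = k + (m+1) := by ring
    rw [Nat.triangle_succ, e]
    simp only [DD]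
    convert h using 2
    · rw [sum_mul]
    · rw [sum_const, card_range]; rw [pow_add]; simp; ring

noncomputable def A (k n : ℕ) : ℝ := DD k 0 n

lemma A_pos (k n : ℕ) : 0 < A k n := DD_pos k 0 n
lemma A_succ (k n : ℕ) : A (k+1) n = A k n - A k (n+2^k) := DD_succ k 0 n
lemma A_zero (n : ℕ) : A 0 n = 1 / ((n:ℝ)+1) := by simp [A, DD, DB]
lemma A_tendsto (k : ℕ) : Tendsto (fun n : ℕ => A k n * (n:ℝ)^(k+1)) atTop (𝓝 (cConst k)) :=
  DD_tendsto k 0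

lemma A_anti (k : ℕ) : Antitone (A k) := by
  apply antitone_nat_of_succ_le
  intro n
  have := DD_diff k 0 n
  have := DD_pos k 1 n
  unfold A; simp at *; linarith

lemma cConst_pos (k : ℕ) : 0 < cConst k := by unfold cConst; positivity

lemma A_tendsto_zero (k : ℕ) : Tendsto (A k) atTop (𝓝 0) := by
  have h := (A_tendsto k).mul ((tendsto_inv_atTop_zero.comp
    (tendsto_natCast_atTop_atTop (R := ℝ))).pow (k+1))
  simp only [ne_eq, Nat.add_eq_zero_iff, one_ne_zero, and_false, not_false_eq_true, zero_pow, mul_zero] at h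
  refine h.congr' ?_
  filter_upwards [eventually_gt_atTop 0] with n hn
  have : (n:ℝ) ≠ 0 := by positivity
  simp only [Function.comp]
  rw [mul_assoc, ← mul_pow, mul_inv_cancel₀ this, one_pow, mul_one]

lemma A_tendsto_zero' (k : ℕ) :
    Tendsto (fun n : ℕ => A (k+1) n * (n:ℝ)^(k+1)) atTop (𝓝 0) := by
  have h := (A_tendsto (k+1)).mul (tendsto_inv_atTop_zero.comp
    (tendsto_natCast_atTop_atTop (R := ℝ)))
  rw [mul_zero] at h
  refine h.congr' ?_
  filter_upwards [eventually_gt_atTop 0] with n hn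
  have : (n:ℝ) ≠ 0 := by positivity
  simp only [Function.comp]
  rw [pow_succ _ (k+1), mul_assoc, mul_assoc, mul_inv_cancel₀ this, mul_one]

/-- tail sums -/
noncomputable def T (k n : ℕ) : ℝ := ∑' j : ℕ, A (k+1) (n + j * 2^(k+1))

lemma A_succ_le (k n : ℕ) : A (k+1) n + A (k+1) (n+2^k) = A k n - A k (n+2^(k+1)) := by
  rw [A_succ, A_succ, show n + 2^k+2^k = n + 2^(k+1) by ring]; ring

lemma T_summable (k n : ℕ) : Summable (fun j : ℕ => A (k+1) (n + j * 2^(k+1))) := by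
  apply summable_of_sum_range_le (c := A k n) (fun j => (A_pos _ _).le)
  intro m
  have h : ∀ m, ∑ i ∈ range m, A (k+1) (n + i * 2^(k+1)) ≤ A k n - A k (n + m * 2^(k+1)) := by
    intro m
    induction m with
    | zero => simp
    | succ m ih =>
      rw [sum_range_succ]
      have h1 := A_succ_le k (n + m * 2^(k+1))
      have h2 := A_pos (k+1) (n + m * 2^(k+1) + 2^k)
      rw [show n + (m+1) * 2^(k+1) = n + m * 2^(k+1) + 2^(k+1) by ring]
      linarith
  linarith [h m, A_pos k (n + m * 2^(k+1))]

lemma T_pos (k n : ℕ) : 0 < T k n :=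
  (T_summable k n).tsum_pos (fun j => (A_pos _ _).le) 0 (A_pos _ _)

lemma T_step (k n : ℕ) : T k n = A (k+1) n + T k (n+2^(k+1)) := by
  unfold T
  rw [(T_summable k n).tsum_eq_zero_add]
  congr 1
  · simp
  · apply tsum_congr; intro j; congr 1; ring

lemma T_anti (k : ℕ) : Antitone (T k) := by
  intro a b hab
  exact (T_summable k b).tsum_le_tsum (fun j => A_anti _ (by omega)) (T_summable k a)

lemma idx_tendsto (k n : ℕ) : Tendsto (fun m : ℕ => n + m * 2^k) atTop atTop := by
  apply tendsto_atTop_mono (f := fun m : ℕ => m) _ tendsto_id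
  intro m
  have : 0 < 2^k := by positivity
  nlinarith

lemma T_add (k n : ℕ) : T k n + T k (n+2^k) = A k n := by
  have h1 := (T_summable k n).hasSum.add (T_summable k (n+2^k)).hasSum
  have h2 := h1.tendsto_sum_nat
  have h3 : Tendsto (fun m : ℕ => A k n - A k (n + m * 2^(k+1))) atTop (𝓝 (A k n - 0)) :=
    ((A_tendsto_zero k).comp (idx_tendsto _ _)).const_sub _
  rw [sub_zero] at h3
  refine tendsto_nhds_unique h2 (h3.congr ?_)
  intro m
  induction m with
  | zero => simp
  | succ m ih =>
    rw [sum_range_succ, ← ih]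
    have h1 := A_succ_le k (n + m * 2^(k+1))
    rw [show n + (m+1) * 2^(k+1) = n + m * 2^(k+1) + 2^(k+1) by ring,
      show n + 2^k + m * 2^(k+1) = n + m * 2^(k+1) + 2^k by ring]
    linarith

lemma T_lt_A (k n : ℕ) : T k n < A k n := by
  linarith [T_add k n, T_pos k (n+2^k)]

lemma T_tendsto (k : ℕ) : Tendsto (fun n : ℕ => T k n * (n:ℝ)^(k+1)) atTop (𝓝 (cConst k / 2)) := by
  have hA := A_tendsto k
  have hS := shift_tendsto (2^k) hA
  have h1 : Tendsto (fun n : ℕ => T k (n+2^k) * (n:ℝ)^(k+1)) atTop (𝓝 (cConst k / 2)) := by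
    refine tendsto_of_tendsto_of_tendsto_of_le_of_le (hS.div_const 2) (hA.div_const 2) ?_ ?_
    · intro n
      have h1 := T_add k (n+2^k)
      have h2 := T_anti k (Nat.le_add_right (n+2^k) (2^k))
      have : A k (n+2^k) / 2 ≤ T k (n+2^k) := by linarith
      have := mul_le_mul_of_nonneg_right this (show 0 ≤ (n:ℝ)^(k+1) by positivity)
      simp only; linarith
    · intro n
      have h1 := T_add k n
      have h2 := T_anti k (Nat.le_add_right n (2^k))
      have : T k (n+2^k) ≤ A k n / 2 := by linarith
      have := mul_le_mul_of_nonneg_right this (show 0 ≤ (n:ℝ)^(k+1) by positivity)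
      simp only; linarith
  have h2 := hA.sub h1
  rw [show cConst k - cConst k / 2 = cConst k / 2 by ring] at h2
  refine h2.congr ?_
  intro n
  rw [← T_add k n]; ring

lemma A_lt_T (k : ℕ) : ∀ᶠ n in atTop, A (k+1) n < T k (n+2^(k+1)) := by
  have h1 := A_tendsto_zero' k
  have h2 := shift_tendsto (2^(k+1)) (T_tendsto k)
  have := cConst_pos k
  filter_upwards [h1.eventually_lt h2 (by positivity)] with n hn
  exact lt_of_mul_lt_mul_right hn (by positivity)

lemma tm_double (n : ℕ) : tmSign (2*n) = tmSign n := by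
  unfold tmSign
  rcases Nat.eq_zero_or_pos n with h | h
  · simp [h]
  · rw [Nat.digits_def' (by norm_num) (by omega)]; simp

lemma tm_double_add (n : ℕ) : tmSign (2*n+1) = - tmSign n := by
  unfold tmSign
  rw [Nat.digits_def' (by norm_num) (by omega)]
  simp only [List.sum_cons]
  rw [show (2*n+1) % 2 = 1 by omega, show (2*n+1)/2 = n by omega, pow_add]; ring

lemma tm_zero : tmSign 0 = 1 := by simp [tmSign]

lemma tm_add_pow (k : ℕ) : ∀ j < 2^k, tmSign (2^k + j) = - tmSign j := by
  induction k with
  | zero =>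
    intro j hj
    have : j = 0 := by simpa using hj
    subst this
    simpa using tm_double_add 0
  | succ k ih =>
    intro j hj
    rw [pow_succ] at hj
    rcases Nat.even_or_odd' j with ⟨i, h | h⟩
    · rw [h, show 2^(k+1) + 2*i = 2*(2^k+i) by ring, tm_double, tm_double, ih i (by omega)]
    · rw [h, show 2^(k+1) + (2*i+1) = 2*(2^k+i)+1 by ring, tm_double_add, tm_double_add,
        ih i (by omega)]

lemma tm_ne (n : ℕ) : tmSign n ≠ 0 := by unfold tmSign; positivity

def Lv (d : ℕ → ℝ) (k n : ℕ) : Prop := ∀ j < 2^k, gg (d (n+j)) = gg (d n) * tmSign j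

def Greedy (d : ℕ → ℝ) : Prop := ∀ n : ℕ, d (n+1) = d n + gg (d n) * A 0 n

lemma Lv_split {d : ℕ → ℝ} {k n : ℕ} (h : Lv d (k+1) n) :
    Lv d k n ∧ Lv d k (n+2^k) ∧ gg (d (n+2^k)) = - gg (d n) := by
  have e : 2^(k+1) = 2^k + 2^k := by ring
  have h0 : gg (d (n+2^k)) = - gg (d n) := by
    rw [h (2^k) (by rw [e]; have : 0 < 2^k := by positivity
                    omega)]
    have := tm_add_pow k 0 (by positivity)
    rw [add_zero, tm_zero] at this
    rw [this]; ring
  refine ⟨fun j hj => h j (by omega), fun j hj => ?_, h0⟩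
  rw [add_assoc, h (2^k+j) (by omega), tm_add_pow k j hj, h0]; ring

lemma Lv_succ {d : ℕ → ℝ} {k n : ℕ} (h : Lv d k n) (h' : Lv d k (n+2^k))
    (h0 : gg (d (n+2^k)) = - gg (d n)) : Lv d (k+1) n := by
  have e : 2^(k+1) = 2^k + 2^k := by ring
  intro j hj
  by_cases hjk : j < 2^k
  · exact h j hjk
  · obtain ⟨i, rfl⟩ := Nat.exists_eq_add_of_le (not_lt.1 hjk)
    rw [← add_assoc, h' i (by omega), h0, tm_add_pow k i (by omega)]; ring

lemma Lv_step {d : ℕ → ℝ} (hd : Greedy d) {k : ℕ} :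
    ∀ {n : ℕ}, Lv d k n → d (n+2^k) = d n + gg (d n) * A k n := by
  induction k with
  | zero => intro n _; simpa using hd n
  | succ k ih =>
    intro n h
    obtain ⟨h1, h2, h3⟩ := Lv_split h
    have e1 := ih h1
    have e2 := ih h2
    rw [show n + 2^(k+1) = n + 2^k + 2^k by ring, e2, h3, e1, A_succ]; ring

lemma class_ind {q n0 : ℕ} {P : ℕ → Prop} (h0 : P n0)
    (step : ∀ n ≥ n0, n ≡ n0 [MOD q] → P n → P (n+q)) :
    ∀ n ≥ n0, n ≡ n0 [MOD q] → P n := by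
  have key : ∀ i : ℕ, P (n0 + q * i) := by
    intro i
    induction i with
    | zero => simpa using h0
    | succ i ih =>
      have := step (n0 + q*i) (by omega) (by simp [Nat.ModEq]) ih
      rwa [show n0 + q * (i+1) = n0 + q*i+q by ring]
  intro n hn hc
  obtain ⟨i, hi⟩ := (Nat.modEq_iff_dvd' hn).1 hc.symm
  rw [show n = n0 + q * i by omega]
  exact key i

lemma modEq_add {n r q : ℕ} (h : n ≡ r [MOD q]) : n + q ≡ r [MOD q] := by
  simpa [Nat.ModEq] using h

lemma bound {d : ℕ → ℝ} (hd : Greedy d) {k r : ℕ}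
    (lv : ∀ᶠ n in atTop, n ≡ r [MOD 2^k] → Lv d k n)
    (cr : ∀ c : ℝ, c = 1 ∨ c = -1 → ∃ᶠ n in atTop, n ≡ r [MOD 2^k] ∧ gg (d n) = c) :
    ∀ᶠ n in atTop, n ≡ r [MOD 2^k] → |d n| ≤ A k (n - 2^k) := by
  have h2k : 0 < 2^k := Nat.two_pow_pos k
  have hs : ∀ᶠ n in atTop, A (k+1) n ≤ A k (n+2^k) := by
    filter_upwards [A_lt_T k] with n hn
    have := T_lt_A k (n+2^(k+1))
    have h2 := A_anti k (show n + 2^k ≤ n+2^(k+1) by rw [pow_succ]; omega)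
    linarith
  obtain ⟨N, hN⟩ := eventually_atTop.1 (lv.and hs)
  have hst : ∀ n ≥ N, n ≡ r [MOD 2^k] → d (n+2^k) = d n + gg (d n) * A k n :=
    fun n hn hr => Lv_step hd ((hN n hn).1 hr)
  obtain ⟨n0, hn0, hr0, hb0⟩ : ∃ n0 ≥ N, n0 ≡ r [MOD 2^k] ∧ |d n0| ≤ A k n0 := by
    by_contra! hcon
    obtain ⟨n1, hn1, hr1, hg1⟩ := frequently_atTop.1 (cr 1 (Or.inl rfl)) N
    obtain ⟨n2, hn2, hr2, hg2⟩ := frequently_atTop.1 (cr (-1) (Or.inr rfl)) n1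
    have := class_ind (q := 2^k) (n0 := n1) (P := fun n => gg (d n) = 1) hg1 (by
      intro n hn hr h
      have hr' := hr.trans hr1
      have h1 := hcon n (by omega) hr'
      by_contra h2
      rw [hst n (by omega) hr'] at h2
      have := gg_ne (by rw [h] at h2 ⊢; exact h2)
      linarith) n2 hn2 (hr2.trans hr1.symm)
    rw [this] at hg2; norm_num at hg2
  have key := class_ind (q := 2^k) (n0 := n0) (P := fun n => |d (n+2^k)| ≤ A k n) (by
      rw [hst n0 hn0 hr0, abs_gg_add, abs_le]
      have := abs_nonneg (d n0)
      constructor <;> linarith [A_pos k n0]) (by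
      intro n hn hr h
      have hr' := hr.trans hr0
      rw [hst (n+2^k) (by omega) (modEq_add hr'), abs_gg_add, abs_le]
      have h1 := (hN n (by omega)).2
      rw [A_succ] at h1
      have := abs_nonneg (d (n+2^k))
      constructor
      · linarith
      · linarith)
  filter_upwards [eventually_ge_atTop (n0+2^k)] with n hn hr
  obtain ⟨m, rfl⟩ := Nat.exists_eq_add_of_le' (show 2^k ≤ n by omega)
  have := key m (by omega) (by
    have : m ≡ r [MOD 2^k] := by simpa [Nat.ModEq] using hr
    exact this.trans hr0.symm)
  simpa using this

structure Good (d : ℕ → ℝ) (k r : ℕ) : Prop where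
  lv : ∀ᶠ n in atTop, n ≡ r [MOD 2^k] → Lv d k n
  cr : ∀ c : ℝ, c = 1 ∨ c = -1 → ∃ᶠ n in atTop, n ≡ r [MOD 2^k] ∧ gg (d n) = c
  out : Tendsto (fun n : ℕ => |d n| * (n:ℝ)^(k+1)) (atTop ⊓ 𝓟 {n | ¬ n ≡ r [MOD 2^k]}) atTop
  outc : 1 ≤ k → ∀ c : ℝ, c = 1 ∨ c = -1 →
    ∃ᶠ n in atTop, ¬ n ≡ r [MOD 2^k] ∧ gg (d n) = c

lemma const_contra {d : ℕ → ℝ} {P : ℕ → Prop} (H : ∀ c : ℝ, c = 1 ∨ c = -1 →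
    ¬ ∀ᶠ n in atTop, P n → gg (d n) = c) :
    ∀ c : ℝ, c = 1 ∨ c = -1 → ∃ᶠ n in atTop, P n ∧ gg (d n) = c := by
  intro c hc hn
  apply H (-c) (by rcases hc with rfl | rfl <;> simp)
  filter_upwards [hn] with n hn hp
  rcases gg_cases (d n) with h | h <;> rcases hc with rfl | rfl
  · exact absurd ⟨hp, h⟩ hn
  · simpa using h
  · simpa using h
  · exact absurd ⟨hp, h⟩ hn

lemma good_zero {d : ℕ → ℝ} (hd : Greedy d) : Good d 0 0 := by
  refine ⟨?_, ?_, ?_, fun h => by omega⟩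
  · refine Eventually.of_forall fun n _ j hj => ?_
    have : j = 0 := by simpa using hj
    subst this
    simp [tm_zero]
  · apply const_contra
    intro c hc hev
    obtain ⟨N, hN⟩ := eventually_atTop.1 hev
    have hc2 : c * c = 1 := by rcases hc with rfl | rfl <;> norm_num
    have h1 : ∀ m : ℕ, c * d (N+m) = c * d N - (∑ i ∈ range N, 1/((i:ℝ)+1)) +
        ∑ i ∈ range (N+m), 1/((i:ℝ)+1) := by
      intro m
      induction m with
      | zero => simp
      | succ m ih =>
        rw [← add_assoc, hd, hN (N+m) (by omega) (by simp [Nat.ModEq, Nat.mod_one]), sum_range_succ, A_zero,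
          mul_add, ih, ← mul_assoc, hc2]
        ring
    have h2 := (tendsto_atTop.1 Real.tendsto_sum_range_one_div_nat_succ_atTop
      (1 - (c * d N - (∑ i ∈ range N, 1/((i:ℝ)+1)))))
    obtain ⟨M, hM⟩ := eventually_atTop.1 h2
    have h3 := hM (N+M) (by omega)
    have h4 := h1 M
    have h5 := hN (N+M) (by omega) (by simp [Nat.ModEq, Nat.mod_one])
    have h6 : c * d (N+M) ≤ 0 := by
      rcases hc with rfl | rfl
      · have := gg_one h5
        linarith [abs_nonneg (d (N+M))]
      · have := gg_neg_one h5
        linarith [abs_nonneg (d (N+M))]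
    linarith
  · have : {n : ℕ | ¬ n ≡ 0 [MOD 2^0]} = ∅ := by
      ext n; simp [Nat.ModEq, Nat.mod_one]
    rw [this]; simp

lemma sub_tendsto (q : ℕ) : Tendsto (fun n : ℕ => n - q) atTop atTop := tendsto_sub_atTop_nat q

lemma d_tendsto {d : ℕ → ℝ} (hd : Greedy d) : Tendsto d atTop (𝓝 0) := by
  have G := good_zero hd
  have h := bound hd G.lv G.cr
  apply squeeze_zero_norm' (a := fun n => A 0 (n - 2^0))
  · filter_upwards [h] with n hn
    exact hn (by simp [Nat.ModEq, Nat.mod_one])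
  · exact (A_tendsto_zero 0).comp (sub_tendsto _)

lemma unshift_tendsto {f : ℕ → ℝ} {e : ℕ} {L : ℝ} (i : ℕ)
    (h : Tendsto (fun n : ℕ => f n * (n:ℝ)^e) atTop (𝓝 L)) :
    Tendsto (fun n : ℕ => f (n-i) * (n:ℝ)^e) atTop (𝓝 L) := by
  rw [← tendsto_add_atTop_iff_nat i]
  have h1 := h.mul ((ratio_tendsto i e).inv₀ one_ne_zero)
  rw [inv_one, mul_one] at h1
  refine h1.congr' ?_
  filter_upwards [eventually_gt_atTop 0] with n hn
  have h2 : ((n + i : ℕ) : ℝ) ≠ 0 := by positivity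
  have h3 : (n : ℝ) ≠ 0 := by positivity
  rw [Nat.add_sub_cancel, mul_assoc, ← inv_pow, ← mul_pow, inv_div, mul_div_cancel₀ _ h3]

lemma class_split {m r' k : ℕ} (h1 : m ≡ r' [MOD 2^k]) (h2 : ¬ m ≡ r' [MOD 2^(k+1)]) :
    m ≡ r' + 2^k [MOD 2^(k+1)] := by
  rw [Nat.modEq_iff_dvd] at *
  obtain ⟨t, ht⟩ := h1
  push_cast at *
  rcases Int.even_or_odd' t with ⟨s, h | h⟩
  · exact absurd ⟨s, by rw [ht, h]; ring⟩ h2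
  · exact ⟨s+1, by rw [show (r':ℤ) + 2^k - m = (r' - m) + 2^k by ring, ht, h]; ring⟩

section layers
variable {d : ℕ → ℝ} {k r r' : ℕ}

lemma bound_lt (hd : Greedy d)
    (lv' : ∀ᶠ n in atTop, n ≡ r' [MOD 2^(k+1)] → Lv d (k+1) n)
    (cr' : ∀ c : ℝ, c = 1 ∨ c = -1 → ∃ᶠ n in atTop, n ≡ r' [MOD 2^(k+1)] ∧ gg (d n) = c) :
    ∀ᶠ n in atTop, n ≡ r' [MOD 2^(k+1)] → |d n| < A k n := by
  have h := bound hd lv' cr'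
  have h2 := (sub_tendsto (2^(k+1))).eventually (A_lt_T k)
  filter_upwards [h, h2, eventually_ge_atTop (2^(k+1))] with n h h2 h3 hr
  rw [Nat.sub_add_cancel h3] at h2
  linarith [h hr, T_lt_A k n]

lemma near (hd : Greedy d)
    (lv' : ∀ᶠ n in atTop, n ≡ r' [MOD 2^(k+1)] → Lv d (k+1) n)
    (cr' : ∀ c : ℝ, c = 1 ∨ c = -1 → ∃ᶠ n in atTop, n ≡ r' [MOD 2^(k+1)] ∧ gg (d n) = c) :
    Tendsto (fun n : ℕ => |d n| * (n:ℝ)^(k+1)) (atTop ⊓ 𝓟 {n | n ≡ r' [MOD 2^(k+1)]}) (𝓝 0) := by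
  have h1 := unshift_tendsto (2^(k+1)) (A_tendsto_zero' k)
  refine squeeze_zero' (Eventually.of_forall fun n => by positivity) ?_ (h1.mono_left inf_le_left)
  rw [eventually_inf_principal]
  filter_upwards [bound hd lv' cr'] with n hn hr
  exact mul_le_mul_of_nonneg_right (hn hr) (by positivity)

lemma far (hd : Greedy d) (lv : ∀ᶠ n in atTop, n ≡ r [MOD 2^k] → Lv d k n)
    (hrr : r' ≡ r [MOD 2^k])
    (lv' : ∀ᶠ n in atTop, n ≡ r' [MOD 2^(k+1)] → Lv d (k+1) n)
    (cr' : ∀ c : ℝ, c = 1 ∨ c = -1 → ∃ᶠ n in atTop, n ≡ r' [MOD 2^(k+1)] ∧ gg (d n) = c) :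
    Tendsto (fun n : ℕ => |d n| * (n:ℝ)^(k+1))
      (atTop ⊓ 𝓟 {n | n ≡ r [MOD 2^k] ∧ ¬ n ≡ r' [MOD 2^(k+1)]}) (𝓝 (cConst k)) := by
  have h1 := unshift_tendsto (2^k + 2^(k+1)) (A_tendsto_zero' k)
  have h2 := unshift_tendsto (2^k) (A_tendsto k)
  have h3 := h2.sub h1
  have h4 := h2.add h1
  rw [sub_zero] at h3
  rw [add_zero] at h4
  have key : ∀ᶠ n in (atTop ⊓ 𝓟 {n | n ≡ r [MOD 2^k] ∧ ¬ n ≡ r' [MOD 2^(k+1)]}),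
      |d n| ≤ A k (n - 2^k) + A (k+1) (n - (2^k+2^(k+1))) ∧
      A k (n - 2^k) - A (k+1) (n - (2^k+2^(k+1))) ≤ |d n| := by
    rw [eventually_inf_principal]
    filter_upwards [(sub_tendsto (2^k)).eventually (bound hd lv' cr'),
      (sub_tendsto (2^k)).eventually lv, eventually_ge_atTop (2^k)] with n hb hl hn hc
    obtain ⟨m, rfl⟩ := Nat.exists_eq_add_of_le' hn
    have hm' : m ≡ r' [MOD 2^(k+1)] :=
      Nat.ModEq.add_right_cancel' _ (class_split (hc.1.trans hrr.symm) hc.2)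
    have hm : m ≡ r [MOD 2^k] := Nat.ModEq.add_right_cancel' (2^k)
      (hc.1.trans (modEq_add (Nat.ModEq.refl r)).symm)
    rw [Nat.sub_add_eq]
    simp only [Nat.add_sub_cancel] at hb hl ⊢
    have hb := hb hm'
    rw [Lv_step hd (hl hm), abs_gg_add]
    have h0 := abs_nonneg (d m)
    constructor
    · rw [abs_le]; constructor <;> linarith [A_pos k m]
    · have := neg_abs_le (|d m| - A k m)
      linarith
  refine tendsto_of_tendsto_of_tendsto_of_le_of_le' (h3.mono_left inf_le_left)
    (h4.mono_left inf_le_left) ?_ ?_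
  · filter_upwards [key] with n hn
    have := mul_le_mul_of_nonneg_right hn.2 (show 0 ≤ (n:ℝ)^(k+1) by positivity)
    linarith
  · filter_upwards [key] with n hn
    have := mul_le_mul_of_nonneg_right hn.1 (show 0 ≤ (n:ℝ)^(k+1) by positivity)
    linarith

lemma farc (hd : Greedy d) (lv : ∀ᶠ n in atTop, n ≡ r [MOD 2^k] → Lv d k n)
    (hrr : r' ≡ r [MOD 2^k])
    (lv' : ∀ᶠ n in atTop, n ≡ r' [MOD 2^(k+1)] → Lv d (k+1) n)
    (cr' : ∀ c : ℝ, c = 1 ∨ c = -1 → ∃ᶠ n in atTop, n ≡ r' [MOD 2^(k+1)] ∧ gg (d n) = c) :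
    ∀ c : ℝ, c = 1 ∨ c = -1 → ∃ᶠ n in atTop,
      (n ≡ r [MOD 2^k] ∧ ¬ n ≡ r' [MOD 2^(k+1)]) ∧ gg (d n) = c := by
  intro c hc
  apply (tendsto_add_atTop_nat (2^k)).frequently
  have h1 := cr' (-c) (by rcases hc with rfl | rfl <;> simp)
  apply (h1.and_eventually lv').mono
  rintro n ⟨⟨hn, hg⟩, hl⟩
  have hnr : n ≡ r [MOD 2^k] := (hn.of_dvd (pow_dvd_pow 2 (Nat.le_succ k))).trans hrr
  refine ⟨⟨modEq_add hnr, ?_⟩, ?_⟩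
  · intro h
    have h2 := h.trans hn.symm
    have h3 : 2^(k+1) ∣ n + 2^k - n := (Nat.modEq_iff_dvd' (Nat.le_add_right _ _)).1 h2.symm
    rw [Nat.add_sub_cancel_left] at h3
    have := Nat.le_of_dvd (by positivity) h3
    rw [pow_succ] at this
    have : 0 < 2^k := by positivity
    omega
  · rw [(Lv_split (hl hn)).2.2, hg]; ring

end layers

def Exc (d : ℕ → ℝ) (k r : ℕ) : Prop := ∀ᶠ n in atTop, n ≡ r [MOD 2^k] → |d n| = T k n

lemma up_pow {d : ℕ → ℝ} {F : Filter ℕ} (hF : F ≤ atTop) {a b : ℕ} (hab : a ≤ b)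
    (h : Tendsto (fun n : ℕ => |d n| * (n:ℝ)^a) F atTop) :
    Tendsto (fun n : ℕ => |d n| * (n:ℝ)^b) F atTop := by
  refine tendsto_atTop_mono' _ ?_ h
  filter_upwards [hF (eventually_ge_atTop 1)] with n hn
  have : (1:ℝ) ≤ n := by exact_mod_cast hn
  exact mul_le_mul_of_nonneg_left (pow_le_pow_right₀ this hab) (abs_nonneg _)

lemma up_pow' {d : ℕ → ℝ} {F : Filter ℕ} (hF : F ≤ atTop) {a b : ℕ} (hab : a < b) {c : ℝ}
    (hc : 0 < c) (h : Tendsto (fun n : ℕ => |d n| * (n:ℝ)^a) F (𝓝 c)) :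
    Tendsto (fun n : ℕ => |d n| * (n:ℝ)^b) F atTop := by
  apply up_pow hF (Nat.succ_le_of_lt hab)
  have h1 : Tendsto (fun n : ℕ => (n:ℝ)) F atTop := tendsto_natCast_atTop_atTop.mono_left hF
  have := h.pos_mul_atTop hc h1
  refine this.congr ?_
  intro n; rw [pow_succ]; ring

lemma inv_T {d : ℕ → ℝ} (hd : Greedy d) {k r n0 : ℕ}
    (hN : ∀ n ≥ n0, (n ≡ r [MOD 2^k] → Lv d k n) ∧ A (k+1) n < T k (n+2^(k+1)))
    (hr : n0 ≡ r [MOD 2^k]) (h0 : |d n0| < T k n0) :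
    ∀ n ≥ n0, n ≡ n0 [MOD 2^(k+1)] → |d n| < T k n ∧ Lv d (k+1) n := by
  have h2k : 0 < 2^k := Nat.two_pow_pos k
  have hl : ∀ n ≥ n0, n ≡ n0 [MOD 2^(k+1)] → |d n| < T k n → Lv d (k+1) n := by
    intro n hn hc h
    have hnr : n ≡ r [MOD 2^k] := (hc.of_dvd (pow_dvd_pow 2 (Nat.le_succ k))).trans hr
    have h1 := (hN n hn).1 hnr
    refine Lv_succ h1 ((hN (n+2^k) (by omega)).1 (modEq_add hnr)) ?_
    rw [Lv_step hd h1, gg_flip (h.trans (T_lt_A k n))]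
  have key := class_ind (q := 2^(k+1)) (n0 := n0) (P := fun n => |d n| < T k n) h0 (by
    intro n hn hc h
    have h1 := hl n hn hc h
    rw [Lv_step hd h1, abs_gg_add, abs_lt]
    have h2 := T_step k n
    have h3 := (hN n hn).2
    have := abs_nonneg (d n)
    constructor <;> linarith)
  exact fun n hn hc => ⟨key n hn hc, hl n hn hc (key n hn hc)⟩

lemma cr_of_lt {d : ℕ → ℝ} (hd : Greedy d) {k n0 : ℕ}
    (H : ∀ n ≥ n0, n ≡ n0 [MOD 2^(k+1)] → |d n| < T k n ∧ Lv d (k+1) n) :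
    ∀ c : ℝ, c = 1 ∨ c = -1 → ∃ᶠ n in atTop, n ≡ n0 [MOD 2^(k+1)] ∧ gg (d n) = c := by
  apply const_contra
  intro c hc hev
  obtain ⟨N, hN⟩ := eventually_atTop.1 hev
  set n1 := n0 + N * 2^(k+1) with hn1
  have hpos : 0 < 2^(k+1) := by positivity
  have hge : N ≤ n1 := by nlinarith
  have hge0 : n0 ≤ n1 := by omega
  have hcl : ∀ m, n1 + m * 2^(k+1) ≡ n0 [MOD 2^(k+1)] := by
    intro m; simp [hn1, Nat.ModEq]
  have hsum : ∀ m, d (n1 + m * 2^(k+1)) =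
      d n1 + c * ∑ i ∈ range m, A (k+1) (n1 + i * 2^(k+1)) := by
    intro m
    induction m with
    | zero => simp
    | succ m ih =>
      rw [show n1 + (m+1) * 2^(k+1) = n1 + m * 2^(k+1) + 2^(k+1) by ring,
        Lv_step hd (H _ (by omega) (hcl m)).2, hN _ (by omega) (hcl m), ih, sum_range_succ]
      ring
  have l1 : Tendsto (fun m => d (n1 + m * 2^(k+1))) atTop (𝓝 0) :=
    (d_tendsto hd).comp (idx_tendsto _ _)
  have l2 : Tendsto (fun m => d (n1 + m * 2^(k+1))) atTop (𝓝 (d n1 + c * T k n1)) := by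
    have := ((T_summable k n1).hasSum.tendsto_sum_nat.const_mul c).const_add (d n1)
    exact this.congr (fun m => (hsum m).symm)
  have h1 := tendsto_nhds_unique l1 l2
  have h2 := (H n1 hge0 (by simpa using hcl 0)).1
  have h3 := abs_lt.1 h2
  rcases hc with rfl | rfl <;> linarith [h3.1, h3.2]

lemma step {d : ℕ → ℝ} (hd : Greedy d) {k r : ℕ} (G : Good d k r) :
    Exc d k r ∨ ∃ r', r' ≡ r [MOD 2^k] ∧ Good d (k+1) r' := by
  by_cases hE : Exc d k r
  · exact Or.inl hE
  right
  have h2k : 0 < 2^k := Nat.two_pow_pos k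
  obtain ⟨N, hN⟩ := eventually_atTop.1 ((G.lv.and (A_lt_T k)).and (bound hd G.lv G.cr))
  have hE' : ∃ᶠ n in atTop, ¬ (n ≡ r [MOD 2^k] → |d n| = T k n) := not_eventually.1 hE
  obtain ⟨n, hn, hne⟩ := frequently_atTop.1 hE' (N + 2^k)
  obtain ⟨hr, hne⟩ := Classical.not_imp.1 hne
  obtain ⟨n0, hn0, hr0, hlt⟩ : ∃ n0 ≥ N, n0 ≡ r [MOD 2^k] ∧ |d n0| < T k n0 := by
    rcases lt_or_gt_of_ne hne with h | h
    · exact ⟨n, by omega, hr, h⟩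
    · refine ⟨n+2^k, by omega, modEq_add hr, ?_⟩
      rw [Lv_step hd ((hN n (by omega)).1.1 hr), abs_gg_add, abs_lt]
      have h1 := (hN n (by omega)).2 hr
      have h2 := (hN (n-2^k) (by omega)).1.2
      have h3 := T_add k n
      rw [A_succ, show n - 2^k + 2^(k+1) = n + 2^k by rw [pow_succ]; omega,
        Nat.sub_add_cancel (by omega)] at h2
      constructor <;> linarith
  have H := inv_T hd (fun m hm => (hN m (by omega)).1) hr0 hlt
  have cr' := cr_of_lt hd H
  have lv' : ∀ᶠ n in atTop, n ≡ n0 [MOD 2^(k+1)] → Lv d (k+1) n := by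
    filter_upwards [eventually_ge_atTop n0] with m hm hc
    exact (H m hm hc).2
  refine ⟨n0, hr0, lv', cr', ?_, ?_⟩
  · have hset : {n | ¬ n ≡ n0 [MOD 2^(k+1)]} ⊆ {n | ¬ n ≡ r [MOD 2^k]} ∪
        {n | n ≡ r [MOD 2^k] ∧ ¬ n ≡ n0 [MOD 2^(k+1)]} := by
      intro m hm
      by_cases h : m ≡ r [MOD 2^k]
      · exact Or.inr ⟨h, hm⟩
      · exact Or.inl h
    have h1 := up_pow inf_le_left (Nat.le_succ (k+1)) G.out
    have h2 := up_pow' inf_le_left (Nat.lt_succ_self (k+1)) (cConst_pos k) (far hd G.lv hr0 lv' cr')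
    refine (h1.sup h2).mono_left ?_
    rw [← inf_sup_left, sup_principal]
    exact inf_le_inf_left _ (principal_mono.2 hset)
  · intro _ c hc
    refine (farc hd G.lv hr0 lv' cr' c hc).mono ?_
    rintro m ⟨⟨_, h⟩, h'⟩
    exact ⟨h, h'⟩

lemma chain {d : ℕ → ℝ} (hd : Greedy d) (k : ℕ) :
    (∃ r, Good d k r) ∨ ∃ h < k, ∃ r, Good d h r ∧ Exc d h r := by
  induction k with
  | zero => exact Or.inl ⟨0, good_zero hd⟩
  | succ k ih =>
    rcases ih with ⟨r, G⟩ | ⟨h, hk, r, H⟩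
    · rcases step hd G with E | ⟨r', _, G'⟩
      · exact Or.inr ⟨k, by omega, r, G, E⟩
      · exact Or.inl ⟨r', G'⟩
    · exact Or.inr ⟨h, by omega, r, H⟩

def Xp (d : ℕ → ℝ) (k : ℕ) : Prop :=
  ∃ N m : ℕ, m < 2^k ∧ ∀ n, N ≤ n → gg (d n) = fPer k (n+1+m)

lemma exc_X {d : ℕ → ℝ} (hd : Greedy d) {k r : ℕ} (G : Good d k r) (E : Exc d k r) :
    Xp d (k+1) := by
  have h2k : 0 < 2^k := Nat.two_pow_pos k
  obtain ⟨N, hN⟩ := eventually_atTop.1 (G.lv.and E)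
  have hflip : ∀ n ≥ N, n ≡ r [MOD 2^k] → gg (d (n+2^k)) = - gg (d n) := by
    intro n hn hr
    rw [Lv_step hd ((hN n hn).1 hr), gg_flip]
    rw [(hN n hn).2 hr]; exact T_lt_A k n
  obtain ⟨n0, hn0, hr0, hg0⟩ := frequently_atTop.1 (G.cr 1 (Or.inl rfl)) N
  have hcl : ∀ n, n ≡ n0 [MOD 2^(k+1)] → n ≡ r [MOD 2^k] := fun n hc =>
    (hc.of_dvd (pow_dvd_pow 2 (Nat.le_succ k))).trans hr0
  have key := class_ind (q := 2^(k+1)) (n0 := n0) (P := fun n => gg (d n) = 1) hg0 (by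
    intro n hn hc h
    have hr := hcl n hc
    rw [show n + 2^(k+1) = n + 2^k + 2^k by ring, hflip _ (by omega) (modEq_add hr),
      hflip _ (by omega) hr, h]; norm_num)
  have hpos : 0 < 2^(k+1) := by positivity
  refine ⟨n0, (2^(k+1) * (n0+1) - (n0+1)) % 2^(k+1), Nat.mod_lt _ hpos, ?_⟩
  intro n hn
  have e1 : (n + 1 + (2^(k+1) * (n0+1) - (n0+1)) % 2^(k+1)) % 2^(k+1) = (n - n0) % 2^(k+1) := by
    rw [Nat.add_mod_mod]
    have : n0 + 1 ≤ 2^(k+1) * (n0+1) := Nat.le_mul_of_pos_left _ hpos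
    rw [show n + 1 + (2^(k+1) * (n0+1) - (n0+1)) = (n - n0) + 2^(k+1) * (n0+1) by omega,
      Nat.add_mul_mod_self_left]
  unfold fPer
  rw [e1]
  have e2 := Nat.div_add_mod (n - n0) (2^(k+1))
  set j := (n-n0) % 2^(k+1) with hj
  have hjlt : j < 2^(k+1) := Nat.mod_lt _ hpos
  set n' := n0 + 2^(k+1) * ((n-n0)/2^(k+1)) with hn'
  have e3 : n = n' + j := by omega
  have hc' : n' ≡ n0 [MOD 2^(k+1)] := by simp [hn', Nat.ModEq]
  have hge : n0 ≤ n' := Nat.le_add_right _ _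
  have hr' := hcl n' hc'
  have hL : Lv d (k+1) n' := Lv_succ ((hN n' (by omega)).1 hr')
    ((hN (n'+2^k) (by omega)).1 (modEq_add hr')) (hflip n' (by omega) hr')
  rw [e3, hL j hjlt, key n' hge hc', one_mul]

lemma fPer_add_mul (k n i : ℕ) : fPer k (n + 2^k * i) = fPer k n := by
  unfold fPer; rw [Nat.add_mul_mod_self_left]

lemma fPer_half (k n : ℕ) : fPer (k+1) (n + 2^k) = - fPer (k+1) n := by
  unfold fPer
  have hpos : 0 < 2^k := by positivity
  have e : 2^(k+1) = 2^k + 2^k := by ring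
  rw [Nat.add_mod n (2^k), Nat.mod_eq_of_lt (show 2^k < 2^(k+1) by omega)]
  have hy : n % 2^(k+1) < 2^(k+1) := Nat.mod_lt _ (by omega)
  set y := n % 2^(k+1)
  by_cases h : y < 2^k
  · rw [Nat.mod_eq_of_lt (by omega), add_comm, tm_add_pow k y h]
  · obtain ⟨j, hj⟩ := Nat.exists_eq_add_of_le (not_lt.1 h)
    rw [hj, show 2^k + j + 2^k = j + 2^(k+1) by omega, Nat.add_mod_right,
      Nat.mod_eq_of_lt (by omega), tm_add_pow k j (by omega)]; ring

lemma good_not_X {d : ℕ → ℝ} {k r : ℕ} (G : Good d k r) (X : Xp d k) : False := by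
  obtain ⟨N, m, _, hX⟩ := X
  obtain ⟨n1, hn1, hr1, hg1⟩ := frequently_atTop.1 (G.cr 1 (Or.inl rfl)) N
  obtain ⟨n2, hn2, hr2, hg2⟩ := frequently_atTop.1 (G.cr (-1) (Or.inr rfl)) n1
  have := class_ind (q := 2^k) (n0 := n1) (P := fun n => gg (d n) = 1) hg1 (by
    intro n hn hr h
    rw [hX _ (by omega)] at h ⊢
    rw [← h, show n + 2^k + 1 + m = n + 1 + m + 2^k * 1 by ring, fPer_add_mul])
    n2 hn2 (hr2.trans hr1.symm)
  rw [this] at hg2; norm_num at hg2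

lemma X_disj {d : ℕ → ℝ} {a b : ℕ} (hab : a ≤ b) (X : Xp d a) (X' : Xp d (b+1)) : False := by
  obtain ⟨N, m, _, hX⟩ := X
  obtain ⟨N', m', _, hX'⟩ := X'
  have h1 := hX (N+N') (by omega)
  have h2 := hX (N+N'+2^b) (by omega)
  have h1' := hX' (N+N') (by omega)
  have h2' := hX' (N+N'+2^b) (by omega)
  rw [show N+N'+2^b+1+m = N+N'+1+m + 2^a * 2^(b-a) by
    rw [← pow_add, show a + (b-a) = b by omega]; ring, fPer_add_mul, ← h1] at h2
  rw [show N+N'+2^b+1+m' = N+N'+1+m' + 2^b by ring, fPer_half, ← h1', h2] at h2'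
  rcases gg_cases (d (N+N')) with h | h <;> rw [h] at h2' <;> norm_num at h2'

def CS (d : ℕ → ℝ) (p : ℕ) (S : Set ℕ) : Set EReal :=
  {x | MapClusterPt x (atTop ⊓ 𝓟 S) (fun n : ℕ => ((d n * (n:ℝ)^p : ℝ) : EReal))}

lemma CS_union (d : ℕ → ℝ) (p : ℕ) (S S' : Set ℕ) : CS d p (S ∪ S') = CS d p S ∪ CS d p S' := by
  ext x
  simp only [CS, Set.mem_ofPred_eq, Set.mem_union, MapClusterPt, ← sup_principal, inf_sup_left,
    Filter.map_sup, clusterPt_sup]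

lemma CS_empty (d : ℕ → ℝ) (p : ℕ) : CS d p ∅ = ∅ := by
  ext x
  simp [CS, MapClusterPt, ClusterPt]

lemma cl_single {F : Filter ℕ} [NeBot F] {u : ℕ → EReal} {L : EReal} (h : Tendsto u F (𝓝 L)) :
    {x | MapClusterPt x F u} = {L} := by
  ext x
  constructor
  · intro hx
    by_contra hne
    have h1 : Disjoint (𝓝 x) (𝓝 L) := disjoint_nhds_nhds.2 hne
    have h2 : (𝓝 x ⊓ map u F).NeBot := hx
    exact h2.ne (le_bot_iff.1 ((inf_le_inf_left _ h).trans h1.eq_bot.le))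
  · rintro rfl
    exact h.mapClusterPt

lemma CS_eq {d : ℕ → ℝ} {p : ℕ} {S : Set ℕ} {L : EReal}
    (h : Tendsto (fun n : ℕ => ((|d n| * (n:ℝ)^p : ℝ) : EReal)) (atTop ⊓ 𝓟 S) (𝓝 L))
    (fr : ∀ c : ℝ, c = 1 ∨ c = -1 → ∃ᶠ n in atTop, n ∈ S ∧ gg (d n) = c) :
    CS d p S = {L, -L} := by
  have hS : S = (S ∩ {n | gg (d n) = -1}) ∪ (S ∩ {n | gg (d n) = 1}) := by
    ext n
    simp only [Set.mem_union, Set.mem_inter_iff, Set.mem_ofPred_eq]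
    have := gg_cases (d n)
    tauto
  have nb : ∀ c : ℝ, c = 1 ∨ c = -1 → NeBot (atTop ⊓ 𝓟 (S ∩ {n | gg (d n) = c})) := by
    intro c hc
    exact frequently_mem_iff_neBot.1 (fr c hc)
  have le : ∀ c : ℝ, atTop ⊓ 𝓟 (S ∩ {n | gg (d n) = c}) ≤ atTop ⊓ 𝓟 S := fun c =>
    inf_le_inf_left _ (principal_mono.2 Set.inter_subset_left)
  rw [hS, CS_union, Set.insert_eq]
  congr 1
  · have := nb (-1) (Or.inr rfl)
    apply cl_single
    refine (h.mono_left (le (-1))).congr' ?_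
    rw [EventuallyEq, eventually_inf_principal]
    refine Eventually.of_forall fun n hn => ?_
    rw [← gg_neg_one hn.2]
  · have := nb 1 (Or.inl rfl)
    apply cl_single
    have h' : Tendsto (fun n : ℕ => -((|d n| * (n:ℝ)^p : ℝ) : EReal))
      (atTop ⊓ 𝓟 S) (𝓝 (-L)) := (continuous_neg.tendsto L).comp h
    refine (h'.mono_left (le 1)).congr' ?_
    rw [EventuallyEq, eventually_inf_principal]
    refine Eventually.of_forall fun n hn => ?_
    rw [← EReal.coe_neg, ← neg_mul, ← gg_one hn.2]

def Outs (k : ℕ) : Set EReal := if k = 0 then ∅ else {⊤, ⊥}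

lemma CS_out {d : ℕ → ℝ} {k r p : ℕ} (G : Good d k r) (hp : k + 1 ≤ p) :
    CS d p {n | ¬ n ≡ r [MOD 2^k]} = Outs k := by
  unfold Outs
  split_ifs with hk
  · subst hk
    have : {n : ℕ | ¬ n ≡ r [MOD 2^0]} = ∅ := by
      ext n; simp [Nat.ModEq, Nat.mod_one]
    rw [this, CS_empty]
  · have := CS_eq (EReal.tendsto_coe_nhds_top_iff.2 (up_pow inf_le_left hp G.out))
      (G.outc (by omega))
    rw [this, EReal.neg_top]

lemma CS_univ (d : ℕ → ℝ) (p k r : ℕ) : CS d p Set.univ =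
    CS d p {n | ¬ n ≡ r [MOD 2^k]} ∪ CS d p {n | n ≡ r [MOD 2^k]} := by
  rw [← CS_union]; congr 1; ext n; simp; tauto

lemma fin_good {d : ℕ → ℝ} (hd : Greedy d) {k r r' : ℕ} (G : Good d k r) (G' : Good d (k+1) r')
    (hrr : r' ≡ r [MOD 2^k]) : CS d (k+1) Set.univ =
      Outs k ∪ ({(cConst k : EReal), -(cConst k : EReal)} ∪ {(0:EReal), -0}) := by
  rw [CS_univ d (k+1) k r, CS_out G le_rfl]
  have hS : {n | n ≡ r [MOD 2^k]} = {n | n ≡ r [MOD 2^k] ∧ ¬ n ≡ r' [MOD 2^(k+1)]} ∪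
      {n | n ≡ r' [MOD 2^(k+1)]} := by
    ext n
    simp only [Set.mem_ofPred_eq, Set.mem_union]
    have : n ≡ r' [MOD 2^(k+1)] → n ≡ r [MOD 2^k] := fun hn =>
      (hn.of_dvd (pow_dvd_pow 2 (Nat.le_succ k))).trans hrr
    tauto
  rw [hS, CS_union, CS_eq (EReal.tendsto_coe.2 (far hd G.lv hrr G'.lv G'.cr))
    (farc hd G.lv hrr G'.lv G'.cr),
    CS_eq (EReal.tendsto_coe.2 (near hd G'.lv G'.cr)) G'.cr]
  simp

lemma exc_tendsto {d : ℕ → ℝ} {k r : ℕ} (E : Exc d k r) :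
    Tendsto (fun n : ℕ => |d n| * (n:ℝ)^(k+1)) (atTop ⊓ 𝓟 {n | n ≡ r [MOD 2^k]})
      (𝓝 (cConst k / 2)) := by
  refine ((T_tendsto k).mono_left inf_le_left).congr' ?_
  rw [EventuallyEq, eventually_inf_principal]
  filter_upwards [E] with n hn hr
  rw [hn hr]

lemma fin_exc {d : ℕ → ℝ} {k r : ℕ} (G : Good d k r) (E : Exc d k r) :
    CS d (k+1) Set.univ =
      Outs k ∪ {((cConst k / 2 : ℝ) : EReal), -((cConst k / 2 : ℝ) : EReal)} := by
  rw [CS_univ d (k+1) k r, CS_out G le_rfl, CS_eq (EReal.tendsto_coe.2 (exc_tendsto E)) G.cr]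

lemma fin_exc_lt {d : ℕ → ℝ} {h k r : ℕ} (hk : h < k) (G : Good d h r) (E : Exc d h r) :
    CS d (k+1) Set.univ = {⊤, ⊥} := by
  have hc := cConst_pos h
  rw [CS_univ d (k+1) h r, CS_out G (by omega), CS_eq (EReal.tendsto_coe_nhds_top_iff.2
    (up_pow' inf_le_left (show h + 1 < k + 1 by omega) (by positivity) (exc_tendsto E))) G.cr,
    EReal.neg_top]
  unfold Outs
  split_ifs <;> simp

lemma greedy_gSigma (τ : ℝ) : Greedy (fun n => gSigma τ n - τ) := by
  intro n
  simp only [gSigma, A_zero, gg, sub_nonpos]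
  ring

lemma Xset_iff (τ : ℝ) (k : ℕ) : τ ∈ Xset k ↔ Xp (fun n => gSigma τ n - τ) k := by
  constructor
  · rintro ⟨N, m, hm, h⟩
    refine ⟨N, m, hm, fun n hn => ?_⟩
    rw [← h (n+1) (by omega) (by omega)]
    simp [gSign, gg]
  · rintro ⟨N, m, hm, h⟩
    refine ⟨N+1, m, hm, fun n hn1 hn => ?_⟩
    obtain ⟨i, rfl⟩ := Nat.exists_eq_add_of_le' hn1
    rw [← h i (by omega)]
    simp [gSign, gg]

lemma limitPts_eq (τ : ℝ) (k : ℕ) :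
    limitPts k τ = CS (fun n => gSigma τ n - τ) (k+1) Set.univ := by
  simp [limitPts, CS]

lemma main_not {d : ℕ → ℝ} (hd : Greedy d) (k : ℕ) (hX : ∀ h, 1 ≤ h → h ≤ k + 1 → ¬ Xp d h) :
    CS d (k+1) Set.univ =
      Outs k ∪ ({(cConst k : EReal), -(cConst k : EReal)} ∪ {(0:EReal), -0}) := by
  rcases chain hd k with ⟨r, G⟩ | ⟨h, hk, r, G, E⟩
  · rcases step hd G with E | ⟨r', hr, G'⟩
    · exact absurd (exc_X hd G E) (hX _ (by omega) le_rfl)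
    · exact fin_good hd G G' hr
  · exact absurd (exc_X hd G E) (hX _ (by omega) (by omega))

lemma main_X {d : ℕ → ℝ} (hd : Greedy d) (k : ℕ) (hX : Xp d (k+1)) :
    CS d (k+1) Set.univ =
      Outs k ∪ {((cConst k / 2 : ℝ) : EReal), -((cConst k / 2 : ℝ) : EReal)} := by
  rcases chain hd k with ⟨r, G⟩ | ⟨h, hk, r, G, E⟩
  · rcases step hd G with E | ⟨r', hr, G'⟩
    · exact fin_exc G E
    · exact (good_not_X G' hX).elim
  · exact (X_disj (by omega) (exc_X hd G E) hX).elim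

lemma main_Y {d : ℕ → ℝ} (hd : Greedy d) (k h : ℕ) (hk : h ≤ k) (hX : Xp d h) :
    CS d (k+1) Set.univ = {⊤, ⊥} := by
  rcases chain hd h with ⟨r, G⟩ | ⟨h', hk', r, G, E⟩
  · exact (good_not_X G hX).elim
  · exact fin_exc_lt (by omega) G E

end GreedyTM

/-- Theorem 1 of the paper: the limit points of
`((σ_n(τ) - τ)·n^{k+1})_n` in `ℝ ∪ {±∞}`. -/
theorem stmt_12 (k : ℕ) (τ : ℝ) :
    (k = 0 → τ ∉ Xset 1 →
      limitPts k τ = {(0 : EReal), (cConst 0 : EReal), ((-(cConst 0) : ℝ) : EReal)}) ∧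
    (k = 0 → τ ∈ Xset 1 →
      limitPts k τ = {((cConst 0 / 2 : ℝ) : EReal), ((-(cConst 0) / 2 : ℝ) : EReal)}) ∧
    (1 ≤ k → τ ∉ Yset (k + 1) →
      limitPts k τ = {(0 : EReal), (cConst k : EReal), ((-(cConst k) : ℝ) : EReal), ⊤, ⊥}) ∧
    (1 ≤ k → τ ∈ Xset (k + 1) →
      limitPts k τ = {((cConst k / 2 : ℝ) : EReal), ((-(cConst k) / 2 : ℝ) : EReal), ⊤, ⊥}) ∧
    (1 ≤ k → τ ∈ Yset k → limitPts k τ = {⊤, ⊥}) := by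
  have hd := GreedyTM.greedy_gSigma τ
  have eh : ((-(cConst k) / 2 : ℝ) : EReal) = -((cConst k / 2 : ℝ) : EReal) := by
    rw [neg_div, EReal.coe_neg]
  refine ⟨?_, ?_, ?_, ?_, ?_⟩
  · rintro rfl hX
    rw [GreedyTM.limitPts_eq, GreedyTM.main_not hd 0 (by
      intro h h1 h2
      rw [show h = 1 by omega, ← GreedyTM.Xset_iff]; exact hX)]
    rw [EReal.coe_neg]
    ext x
    simp only [GreedyTM.Outs, if_true, Set.mem_union, Set.mem_insert_iff,
      Set.mem_singleton_iff, neg_zero, Set.mem_empty_iff_false]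
    tauto
  · rintro rfl hX
    rw [GreedyTM.limitPts_eq, GreedyTM.main_X hd 0 ((GreedyTM.Xset_iff _ _).1 hX), eh]
    simp [GreedyTM.Outs]
  · intro hk hX
    rw [GreedyTM.limitPts_eq, GreedyTM.main_not hd k (by
      intro h h1 h2 h3
      rw [← GreedyTM.Xset_iff] at h3
      apply hX
      simp only [Yset, Set.mem_iUnion]
      exact ⟨h, Finset.mem_Icc.2 ⟨h1, h2⟩, h3⟩)]
    rw [EReal.coe_neg]
    have : k ≠ 0 := by omega
    ext x
    simp only [GreedyTM.Outs, this, if_false, Set.mem_union, Set.mem_insert_iff,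
      Set.mem_singleton_iff, neg_zero]
    tauto
  · intro hk hX
    rw [GreedyTM.limitPts_eq, GreedyTM.main_X hd k ((GreedyTM.Xset_iff _ _).1 hX), eh]
    have : k ≠ 0 := by omega
    ext x
    simp only [GreedyTM.Outs, this, if_false, Set.mem_union, Set.mem_insert_iff,
      Set.mem_singleton_iff]
    tauto
  · intro hk hX
    simp only [Yset, Set.mem_iUnion] at hX
    obtain ⟨h, hh, hX⟩ := hX
    rw [GreedyTM.limitPts_eq,
      GreedyTM.main_Y hd k h (Finset.mem_Icc.1 hh).2 ((GreedyTM.Xset_iff _ _).1 hX)]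
end

section
/- For Lebesgue-almost every τ ∈ ℝ one has liminf_{n→∞} (log|τ − σ_n(τ)|)/(log n)^2 = −1/log 4. -/
open Filter MeasureTheory

namespace Greedy

/-- alternating Thue-Morse differences of the harmonic sequence -/
noncomputable def D : ℕ → ℕ → ℝ
  | 0, n => 1 / ((n : ℝ) + 1)
  | k + 1, n => D k n - D k (n + 2 ^ k)

noncomputable def phi : ℕ → ℝ → ℝ
  | 0, _ => 1
  | k + 1, x => phi k x * (1 - x ^ (2 ^ k))

noncomputable def dphi : ℕ → ℝ → ℝ
  | 0, _ => 0
  | k + 1, x => dphi k x * (1 - x ^ (2 ^ k)) - phi k x * ((2 ^ k : ℕ) * x ^ (2 ^ k - 1))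

lemma phi_hasDeriv (k : ℕ) (x : ℝ) : HasDerivAt (phi k) (dphi k x) x := by
  induction k with
  | zero => exact hasDerivAt_const x 1
  | succ k ih =>
    have h1 : HasDerivAt (fun x : ℝ => 1 - x ^ (2 ^ k)) (-((2 ^ k : ℕ) * x ^ (2 ^ k - 1))) x := by
      simpa using (hasDerivAt_pow (2 ^ k) x).const_sub 1
    have h2 := ih.mul h1
    have e : phi (k + 1) = phi k * fun x : ℝ => 1 - x ^ (2 ^ k) := by
      rfl
    rw [e]
    refine h2.congr_deriv ?_
    show _ = dphi k x * (1 - x ^ (2 ^ k)) - phi k x * ((2 ^ k : ℕ) * x ^ (2 ^ k - 1))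
    ring

lemma phi_cont (k : ℕ) : Continuous (phi k) :=
  continuous_iff_continuousAt.2 fun x => (phi_hasDeriv k x).continuousAt

lemma dphi_cont (k : ℕ) : Continuous (dphi k) := by
  induction k with
  | zero => exact continuous_const
  | succ k ih =>
    have := phi_cont k
    show Continuous fun x => dphi k x * (1 - x ^ (2 ^ k)) - phi k x * ((2 ^ k : ℕ) * x ^ (2 ^ k - 1))
    fun_prop

lemma phi_nonneg (k : ℕ) (x : ℝ) (h0 : 0 ≤ x) (h1 : x ≤ 1) : 0 ≤ phi k x := by
  induction k with
  | zero => simp [phi]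
  | succ k ih =>
    have : x ^ (2 ^ k) ≤ 1 := pow_le_one₀ h0 h1
    exact mul_nonneg ih (by linarith)

lemma D_int (k n : ℕ) : D k n = ∫ x in (0 : ℝ)..1, x ^ n * phi k x := by
  induction k generalizing n with
  | zero => simp [D, phi]
  | succ k ih =>
    rw [D, ih, ih, ← intervalIntegral.integral_sub]
    · apply intervalIntegral.integral_congr
      intro x _
      simp only [phi, pow_add]
      ring
    · exact ((continuous_pow n).mul (phi_cont k)).intervalIntegrable _ _
    · exact ((continuous_pow _).mul (phi_cont k)).intervalIntegrable _ _

lemma D_nonneg (k n : ℕ) : 0 ≤ D k n := by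
  rw [D_int]
  apply intervalIntegral.integral_nonneg (by norm_num)
  intro x hx
  exact mul_nonneg (pow_nonneg hx.1 _) (phi_nonneg k x hx.1 hx.2)

lemma D_anti (k n m : ℕ) (h : n ≤ m) : D k m ≤ D k n := by
  rw [D_int, D_int]
  apply intervalIntegral.integral_mono_on (by norm_num)
  · exact ((continuous_pow _).mul (phi_cont k)).intervalIntegrable _ _
  · exact ((continuous_pow _).mul (phi_cont k)).intervalIntegrable _ _
  · intro x hx
    exact mul_le_mul_of_nonneg_right (pow_le_pow_of_le_one hx.1 hx.2 h) (phi_nonneg k x hx.1 hx.2)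

lemma D_anti_k (k n : ℕ) : D (k + 1) n ≤ D k n := by
  have := D_nonneg k (n + 2 ^ k)
  rw [D]; linarith

/-- `psi k = - x * phi' k`. -/
lemma psi_succ (k : ℕ) (x : ℝ) :
    -(x * dphi (k + 1) x) = -(x * dphi k x) * (1 - x ^ (2 ^ k)) + 2 ^ k * x ^ (2 ^ k) * phi k x := by
  have : x ^ (2 ^ k) = x * x ^ (2 ^ k - 1) := by
    rw [← pow_succ']; congr 1; have := Nat.one_le_two_pow (n := k); omega
  rw [dphi]
  rw [this]; push_cast; ring

lemma psi_bounds (k : ℕ) (x : ℝ) (h0 : 0 ≤ x) (h1 : x ≤ 1) :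
    ((k : ℝ) + 1) * 2 ^ k * (x ^ (2 ^ k) * phi k x) ≤ -(x * dphi (k + 1) x) ∧
      -(x * dphi (k + 1) x) ≤ ((k : ℝ) + 1) * 2 ^ k * phi k x := by
  induction k with
  | zero => simp [dphi, phi]; exact h1
  | succ k ih =>
    rw [psi_succ (k + 1)]
    set z := x ^ (2 ^ k) with hz
    have hy : x ^ (2 ^ (k + 1)) = z ^ 2 := by rw [hz, ← pow_mul, pow_succ]
    have hz0 : 0 ≤ z := pow_nonneg h0 _
    have hz1 : z ≤ 1 := pow_le_one₀ h0 h1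
    have hp := phi_nonneg k x h0 h1
    have hp1 : phi (k + 1) x = phi k x * (1 - z) := rfl
    rw [hy, hp1]
    set P := phi k x
    set Q := -(x * dphi (k + 1) x)
    have hy1 : 0 ≤ 1 - z ^ 2 := by nlinarith
    have a1 := mul_le_mul_of_nonneg_right ih.1 hy1
    have a2 := mul_le_mul_of_nonneg_right ih.2 hy1
    have hc : 0 ≤ ((k : ℝ) + 1) * 2 ^ k := by positivity
    have hPz : 0 ≤ P * (1 - z) := mul_nonneg hp (by linarith)
    have hcP : 0 ≤ ((k : ℝ) + 1) * 2 ^ k * (P * (1 - z)) := mul_nonneg hc hPz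
    have h2 : (0 : ℝ) ≤ 2 ^ k * (P * (1 - z)) := by positivity
    push_cast
    rw [pow_succ (2 : ℝ) k]
    constructor
    · have : 0 ≤ ((k : ℝ) + 1) * 2 ^ k * (P * (1 - z)) * (z * (1 - z)) :=
        mul_nonneg hcP (mul_nonneg hz0 (by linarith))
      nlinarith
    · have e1 : 0 ≤ ((k : ℝ) + 1) * 2 ^ k * (P * (1 - z)) * (1 - z) :=
        mul_nonneg hcP (by linarith)
      have e2 : 0 ≤ 2 ^ k * (P * (1 - z)) * (1 - z ^ 2) := mul_nonneg h2 hy1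
      nlinarith

lemma D_ibp (k n : ℕ) :
    ((n : ℝ) + 1) * D (k + 1) n = ∫ x in (0 : ℝ)..1, x ^ n * -(x * dphi (k + 1) x) := by
  have h : ∫ x in (0 : ℝ)..1, (((n : ℝ) + 1) * x ^ n * phi (k + 1) x + x ^ (n + 1) * dphi (k + 1) x)
      = (1 : ℝ) ^ (n + 1) * phi (k + 1) 1 - (0 : ℝ) ^ (n + 1) * phi (k + 1) 0 := by
    apply intervalIntegral.integral_eq_sub_of_hasDerivAt (f := fun x => x ^ (n + 1) * phi (k + 1) x)
    · intro x _
      have := (hasDerivAt_pow (n + 1) x).mul (phi_hasDeriv (k + 1) x)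
      refine this.congr_deriv ?_
      push_cast; simp
    · apply Continuous.intervalIntegrable
      have := phi_cont (k + 1)
      have := dphi_cont (k + 1)
      fun_prop
  rw [D_int, ← intervalIntegral.integral_const_mul]
  rw [intervalIntegral.integral_add] at h
  · have e : phi (k + 1) 1 = 0 := by simp [phi]
    rw [e] at h
    have h3 : ∫ x in (0 : ℝ)..1, x ^ n * -(x * dphi (k + 1) x)
        = - ∫ x in (0 : ℝ)..1, x ^ (n + 1) * dphi (k + 1) x := by
      rw [← intervalIntegral.integral_neg]
      apply intervalIntegral.integral_congr
      intro x _
      simp only [pow_succ]; ring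
    rw [h3]
    have h4 : ∫ x in (0 : ℝ)..1, ((n : ℝ) + 1) * (x ^ n * phi (k + 1) x)
      = ∫ x in (0 : ℝ)..1, ((n : ℝ) + 1) * x ^ n * phi (k + 1) x := by
      apply intervalIntegral.integral_congr
      intro x _
      simp only []; ring
    rw [h4]
    simp at h
    linarith
  · apply Continuous.intervalIntegrable
    have := phi_cont (k + 1)
    fun_prop
  · apply Continuous.intervalIntegrable
    have := dphi_cont (k + 1)
    fun_prop

lemma D_ub (k n : ℕ) : ((n : ℝ) + 1) * D (k + 1) n ≤ ((k : ℝ) + 1) * 2 ^ k * D k n := by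
  rw [D_ibp, D_int, ← intervalIntegral.integral_const_mul]
  have c1 := phi_cont k
  have c2 := dphi_cont (k + 1)
  apply intervalIntegral.integral_mono_on (by norm_num)
  · apply Continuous.intervalIntegrable; fun_prop
  · apply Continuous.intervalIntegrable; fun_prop
  · intro x hx
    have := mul_le_mul_of_nonneg_left (psi_bounds k x hx.1 hx.2).2 (pow_nonneg hx.1 n)
    linarith

lemma D_lb (k n : ℕ) : ((k : ℝ) + 1) * 2 ^ k * D k n ≤
    ((n : ℝ) + 1 + ((k : ℝ) + 1) * 2 ^ k) * D (k + 1) n := by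
  have c1 := phi_cont k
  have c2 := dphi_cont (k + 1)
  have h : ((k : ℝ) + 1) * 2 ^ k * D k (n + 2 ^ k) ≤ ((n : ℝ) + 1) * D (k + 1) n := by
    rw [D_ibp, D_int, ← intervalIntegral.integral_const_mul]
    apply intervalIntegral.integral_mono_on (by norm_num)
    · apply Continuous.intervalIntegrable; fun_prop
    · apply Continuous.intervalIntegrable; fun_prop
    · intro x hx
      have := mul_le_mul_of_nonneg_left (psi_bounds k x hx.1 hx.2).1 (pow_nonneg hx.1 n)
      rw [pow_add]
      linarith
  have e : D k (n + 2 ^ k) = D k n - D (k + 1) n := by rw [D]; ring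
  rw [e] at h
  linarith

lemma D_pos (k n : ℕ) : 0 < D k n := by
  induction k with
  | zero => simp only [D]; positivity
  | succ k ih =>
    have := D_lb k n
    have h2 : 0 < ((k : ℝ) + 1) * 2 ^ k * D k n := by positivity
    exact pos_of_mul_pos_right (h2.trans_le this) (by positivity)

/-- orbit of the folded dynamics -/
noncomputable def F (n : ℕ) : ℕ → ℝ → ℝ
  | 0, u => u
  | j + 1, u => |F n j u - 1 / ((n : ℝ) + j + 1)|

lemma F_add (n i j : ℕ) (u : ℝ) : F n (i + j) u = F (n + i) j (F n i u) := by
  induction j with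
  | zero => rfl
  | succ j ih =>
    show F n ((i + j) + 1) u = _
    simp only [F]
    rw [ih]; push_cast; ring_nf

lemma F_nonneg (n j : ℕ) (u : ℝ) (hu : 0 ≤ u) : 0 ≤ F n j u := by
  cases j with
  | zero => exact hu
  | succ j => exact abs_nonneg _

lemma gs (τ : ℝ) (n : ℕ) :
    |τ - gSigma τ (n + 1)| = |(|τ - gSigma τ n|) - 1 / ((n : ℝ) + 1)| := by
  rw [gSigma]
  split_ifs with h
  · rw [abs_of_nonneg (sub_nonneg.2 h)]; congr 1; ring
  · rw [abs_of_neg (by linarith : τ - gSigma τ n < 0), ← abs_neg]; congr 1; ring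

lemma gs_F (τ : ℝ) (n j : ℕ) : |τ - gSigma τ (n + j)| = F n j |τ - gSigma τ n| := by
  induction j with
  | zero => rfl
  | succ j ih =>
    rw [← add_assoc, gs, ih, F]; push_cast; ring_nf

lemma cond (k n : ℕ) (h : 3 * (k + 1) * 2 ^ (k + 1) ≤ 2 * (n + 1)) :
    D (k + 1) n ≤ D k (n + 2 ^ (k + 1)) := by
  have h1 := D_ub k n
  have h2 : (3 : ℝ) * (((k : ℝ) + 1) * 2 ^ k) ≤ n + 1 := by
    have : 3 * ((k + 1) * 2 ^ k) ≤ n + 1 := by rw [pow_succ] at h; nlinarith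
    exact_mod_cast this
  have h3 : 3 * D (k + 1) n ≤ D k n := by
    have hp := D_nonneg k n
    have hn : (0 : ℝ) < n + 1 := by positivity
    by_contra hc
    push Not at hc
    nlinarith
  have e1 : D k (n + 2 ^ (k + 1)) = D k (n + 2 ^ k) - D (k + 1) (n + 2 ^ k) := by
    rw [D, add_assoc, ← two_mul, ← pow_succ']; ring
  have e2 : D k (n + 2 ^ k) = D k n - D (k + 1) n := by rw [D]; ring
  have e3 := D_anti (k + 1) n (n + 2 ^ k) (Nat.le_add_right _ _)
  linarith

lemma S (k n : ℕ) (h : 3 * k * 2 ^ k ≤ 2 * (n + 1)) :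
    (∀ u, 0 ≤ u → u ≤ D k n → F n (2 ^ (k + 1)) u = |D (k + 1) n - u|) ∧
    ∀ j, j < 2 ^ (k + 1) → ∃ c : ℝ, (∀ u, 0 ≤ u → u ≤ D k n → F n j u = c + u) ∨
      (∀ u, 0 ≤ u → u ≤ D k n → F n j u = c - u) := by
  induction k generalizing n with
  | zero =>
    have key : ∀ u : ℝ, 0 ≤ u → u ≤ D 0 n → F n 1 u = 1 / ((n : ℝ) + 1) - u := by
      intro u h0 h1
      simp only [D] at h1
      simp only [F]
      rw [abs_of_nonpos (by simpa using h1)]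
      simp
    constructor
    · intro u h0 h1
      have : F n 2 u = |F n 1 u - 1 / ((n : ℝ) + (1 : ℕ) + 1)| := rfl
      show F n 2 u = _
      rw [this, key u h0 h1]
      simp only [D]
      congr 1
      push_cast
      ring
    · intro j hj
      have : j = 0 ∨ j = 1 := by simp at hj; omega
      rcases this with rfl | rfl
      · exact ⟨0, Or.inl fun u _ _ => by simp [F]⟩
      · exact ⟨1 / ((n : ℝ) + 1), Or.inr key⟩
  | succ k ih =>
    have hc := cond k n h
    have hk : 3 * k * 2 ^ k ≤ 3 * (k + 1) * 2 ^ (k + 1) :=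
      Nat.mul_le_mul (by omega) (Nat.pow_le_pow_right (by norm_num) (by omega))
    obtain ⟨a1, a2⟩ := ih n (hk.trans h)
    obtain ⟨b1, b2⟩ := ih (n + 2 ^ (k + 1)) (hk.trans (h.trans (by generalize 2 ^ (k + 1) = q; omega)))
    have hD := D_anti_k k n
    have f1 : ∀ u, 0 ≤ u → u ≤ D (k + 1) n → F n (2 ^ (k + 1)) u = D (k + 1) n - u := by
      intro u h0 h1
      rw [a1 u h0 (h1.trans hD), abs_of_nonneg (by linarith)]
    have split : 2 ^ (k + 1 + 1) = 2 ^ (k + 1) + 2 ^ (k + 1) := by ring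
    constructor
    · intro u h0 h1
      rw [split, F_add, f1 u h0 h1, b1 _ (by linarith) (by linarith)]
      have e : D (k + 2) n = D (k + 1) n - D (k + 1) (n + 2 ^ (k + 1)) := by rw [D]
      rw [e, ← abs_neg]
      congr 1; ring
    · intro j hj
      by_cases hj1 : j < 2 ^ (k + 1)
      · obtain ⟨c, hc'⟩ := a2 j hj1
        refine ⟨c, hc'.imp ?_ ?_⟩ <;> exact fun g u h0 h1 => g u h0 (h1.trans hD)
      · obtain ⟨i, rfl⟩ := Nat.exists_eq_add_of_le (not_lt.1 hj1)
        obtain ⟨c, hc'⟩ := b2 i (by omega)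
        rcases hc' with g | g
        · refine ⟨c + D (k + 1) n, Or.inr fun u h0 h1 => ?_⟩
          rw [F_add, f1 u h0 h1, g _ (by linarith) (by linarith)]; ring
        · refine ⟨c - D (k + 1) n, Or.inl fun u h0 h1 => ?_⟩
          rw [F_add, f1 u h0 h1, g _ (by linarith) (by linarith)]; ring

lemma E (k n : ℕ) (h : 3 * k * 2 ^ k ≤ 2 * (n + 1)) (u : ℝ) (h0 : 0 ≤ u) (h1 : u ≤ D k n) :
    F (n + 2 ^ k) (2 ^ k) u = |D k (n + 2 ^ k) - u| := by
  cases k with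
  | zero =>
    simp only [D, pow_zero, F]
    rw [← abs_neg]; congr 1; push_cast; ring
  | succ k =>
    have hk : 3 * k * 2 ^ k ≤ 3 * (k + 1) * 2 ^ (k + 1) :=
      Nat.mul_le_mul (by omega) (Nat.pow_le_pow_right (by norm_num) (by omega))
    exact (S k (n + 2 ^ (k + 1)) (hk.trans (h.trans (by generalize 2 ^ (k + 1) = q; omega)))).1 u h0 (h1.trans (cond k n h))


lemma gs_const (m : ℕ) : ∀ x y : ℝ, x ≤ y →
    (∀ p, x < p → p ≤ y → ∀ j, j < m → gSigma p j ≠ p) → gSigma x m = gSigma y m := by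
  induction m with
  | zero => intro x y _ _; rfl
  | succ m ih =>
    intro x y hxy H
    have e := ih x y hxy fun p h1 h2 j hj => H p h1 h2 j (by omega)
    rw [gSigma, gSigma, ← e]
    by_cases h1 : gSigma x m ≤ x
    · rw [if_pos h1, if_pos (h1.trans hxy)]
    · by_cases h2 : gSigma x m ≤ y
      · exfalso
        push Not at h1
        have e2 := ih x (gSigma x m) h1.le fun p g1 g2 j hj => H p g1 (g2.trans h2) j (by omega)
        exact H (gSigma x m) h1 h2 m (by omega) e2.symm
      · rw [if_neg h1, if_neg h2]

def Zset (R : ℝ) (n : ℕ) : Set ℝ := {p | p ∈ Set.Icc (-R) R ∧ ∃ m, m < n ∧ gSigma p m = p}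

lemma Zset_mono (R : ℝ) {n m : ℕ} (h : n ≤ m) : Zset R n ⊆ Zset R m := by
  rintro p ⟨h1, j, hj, h2⟩
  exact ⟨h1, j, hj.trans_le h, h2⟩

lemma count_lem (R h : ℝ) (hh : 0 < h) (A : Finset ℝ) (Y : Set ℝ) (hY : Y ⊆ Set.Icc (-R) R)
    (H : ∀ p ∈ Y, ∀ q ∈ Y, p < q → (∀ z ∈ A, p < z → ¬ z ≤ q) → h ≤ q - p) :
    Y.Finite ∧ Y.ncard ≤ A.card + ⌊2 * R / h⌋₊ + 1 := by
  classical
  let f : ℝ → ℕ := fun y => (A.filter (· ≤ y)).card + ⌊(y + R) / h⌋₊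
  have key : ∀ p ∈ Y, ∀ q ∈ Y, p < q → f p < f q := by
    intro p hp q hq hpq
    have s1 : A.filter (· ≤ p) ⊆ A.filter (· ≤ q) := by
      intro z hz
      simp only [Finset.mem_filter] at hz ⊢
      exact ⟨hz.1, hz.2.trans hpq.le⟩
    have s2 : ⌊(p + R) / h⌋₊ ≤ ⌊(q + R) / h⌋₊ := by
      apply Nat.floor_le_floor; gcongr
    have s3 := Finset.card_le_card s1
    by_contra hc
    have hc1 : (A.filter (· ≤ p)).card + ⌊(p + R) / h⌋₊ ≥ (A.filter (· ≤ q)).card + ⌊(q + R) / h⌋₊ :=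
      not_lt.1 hc
    have e1 : A.filter (· ≤ p) = A.filter (· ≤ q) := Finset.eq_of_subset_of_card_le s1 (by omega)
    have := H p hp q hq hpq (by
      intro z hz h1 h2
      have : z ∈ A.filter (· ≤ q) := Finset.mem_filter.2 ⟨hz, h2⟩
      rw [← e1] at this
      exact absurd (Finset.mem_filter.1 this).2 (not_le.2 h1))
    have e2 : ⌊(p + R) / h⌋₊ + 1 ≤ ⌊(q + R) / h⌋₊ := by
      rw [← Nat.floor_add_one (div_nonneg (by linarith [(hY hp).1]) hh.le)]
      apply Nat.floor_le_floor
      rw [div_add_one hh.ne']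
      exact div_le_div_of_nonneg_right (by linarith) hh.le
    omega
  have inj : Set.InjOn f Y := by
    intro p hp q hq e
    rcases lt_trichotomy p q with h1 | h1 | h1
    · exact absurd e (key p hp q hq h1).ne
    · exact h1
    · exact absurd e (key q hq p hp h1).ne'
  have maps : Set.MapsTo f Y (Finset.range (A.card + ⌊2 * R / h⌋₊ + 1) : Finset ℕ) := by
    intro y hy
    simp only [Finset.coe_range, Set.mem_Iio]
    have := Finset.card_filter_le A (· ≤ y)
    have : ⌊(y + R) / h⌋₊ ≤ ⌊2 * R / h⌋₊ := by
      apply Nat.floor_le_floor; gcongr; linarith [(hY hy).2]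
    show (A.filter (· ≤ y)).card + ⌊(y + R) / h⌋₊ < _
    omega
  refine ⟨Set.Finite.of_injOn maps inj (Finset.finite_toSet _), ?_⟩
  have := Set.ncard_le_ncard_of_injOn f maps inj (Finset.finite_toSet _)
  rwa [Set.ncard_coe_finset, Finset.card_range] at this

lemma no_zero (k n j : ℕ) (h : 3 * k * 2 ^ k ≤ 2 * (n + 1)) (hj : j < 2 ^ (k + 1)) (w : ℝ)
    (h0 : 0 ≤ w) (h1 : w < D k n) (hz : F n j w = 0) : w = 0 := by
  obtain ⟨c, hc | hc⟩ := (S k n h).2 j hj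
  · have a := hc 0 le_rfl (D_nonneg _ _)
    have b := F_nonneg n j 0 le_rfl
    have := hc w h0 h1.le
    linarith
  · have a := hc _ (D_nonneg _ _) le_rfl
    have b := F_nonneg n j _ (D_nonneg k n)
    have := hc w h0 h1.le
    linarith

lemma doubling (R : ℝ) (k n : ℕ) (h : 3 * k * 2 ^ k ≤ 2 * (n + 1)) (hf : (Zset R n).Finite) (d : ℝ)
    (hd : 0 < d) (hD : d ≤ D k (n + 2 ^ (k + 1))) :
    (Zset R (n + 2 ^ (k + 1))).Finite ∧
      (Zset R (n + 2 ^ (k + 1))).ncard ≤ 2 * (Zset R n).ncard + ⌊2 * R / d⌋₊ + 1 := by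
  classical
  set Y : Set ℝ := {p | p ∈ Set.Icc (-R) R ∧ ∃ i, i < 2 ^ (k + 1) ∧ gSigma p (n + i) = p} with hY
  have hU : Zset R (n + 2 ^ (k + 1)) = Zset R n ∪ Y := by
    ext p
    constructor
    · rintro ⟨h1, m, hm, h2⟩
      by_cases hmn : m < n
      · exact Or.inl ⟨h1, m, hmn, h2⟩
      · obtain ⟨i, rfl⟩ := Nat.exists_eq_add_of_le (not_lt.1 hmn)
        exact Or.inr ⟨h1, i, by omega, h2⟩
    · rintro (⟨h1, m, hm, h2⟩ | ⟨h1, i, hi, h2⟩)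
      · exact ⟨h1, m, Nat.lt_add_right _ hm, h2⟩
      · exact ⟨h1, n + i, by omega, h2⟩
  obtain ⟨c1, c2⟩ := count_lem R d hd hf.toFinset Y (fun p hp => hp.1) (by
    intro p hp q hq hpq hz
    by_contra hlt
    push Not at hlt
    have ex : ∃ i, ∃ r ∈ Set.Icc p q, gSigma r (n + i) = r := by
      obtain ⟨_, i, _, e⟩ := hp
      exact ⟨i, p, ⟨le_rfl, hpq.le⟩, e⟩
    obtain ⟨r, hr, er⟩ := Nat.find_spec ex
    have hmin : ∀ i, i < Nat.find ex → ¬ ∃ r ∈ Set.Icc p q, gSigma r (n + i) = r :=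
      fun i hi => Nat.find_min ex hi
    set i0 := Nat.find ex with hi0
    have noz : ∀ s, p < s → s ≤ q → ∀ j, j < n + i0 → gSigma s j ≠ s := by
      intro s h1 h2 j hj e
      by_cases hjn : j < n
      · refine hz s ?_ h1 h2
        rw [Set.Finite.mem_toFinset]
        exact ⟨⟨by linarith [hp.1.1], h2.trans hq.1.2⟩, j, hjn, e⟩
      · obtain ⟨i, rfl⟩ := Nat.exists_eq_add_of_le (not_lt.1 hjn)
        exact hmin i (by omega) ⟨s, ⟨h1.le, h2⟩, e⟩
    have cst : ∀ x ∈ Set.Icc p q, gSigma x (n + i0) = r := by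
      intro x hx
      rcases le_total x r with h1 | h1
      · rw [gs_const (n + i0) x r h1 fun s g1 g2 => noz s (hx.1.trans_lt g1) (g2.trans hr.2), er]
      · rw [← gs_const (n + i0) r x h1 fun s g1 g2 => noz s (hr.1.trans_lt g1) (g2.trans hx.2), er]
    have only : ∀ x ∈ Y, x ∈ Set.Icc p q → x = r := by
      rintro x ⟨_, i, hi, ei⟩ hx
      have hle : i0 ≤ i := by
        by_contra hlt'
        exact hmin i (not_le.1 hlt') ⟨x, hx, ei⟩
      obtain ⟨j, rfl⟩ := Nat.exists_eq_add_of_le hle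
      have g := gs_F x (n + i0) j
      rw [add_assoc, ei, cst x hx, sub_self, abs_zero] at g
      have hlt2 : |x - r| < D k (n + i0) := by
        have : d ≤ D k (n + i0) := hD.trans (D_anti _ _ _ (by omega))
        rw [abs_lt]
        constructor <;> linarith [hx.1, hx.2, hr.1, hr.2]
      have := no_zero k (n + i0) j (h.trans (by omega)) (by omega) _ (abs_nonneg _) hlt2 g.symm
      rw [abs_eq_zero] at this
      linarith
    have e1 := only p hp ⟨le_rfl, hpq.le⟩
    have e2 := only q hq ⟨hpq.le, le_rfl⟩
    linarith)
  rw [hU]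
  refine ⟨hf.union c1, (Set.ncard_union_le _ _).trans ?_⟩
  rw [← Set.ncard_eq_toFinset_card _ hf] at c2
  omega

lemma doubling_iter (R : ℝ) (k n : ℕ) (h : 3 * k * 2 ^ k ≤ 2 * (n + 1)) (hf : (Zset R n).Finite)
    (d : ℝ) (hd : 0 < d) (t : ℕ) (hD : d ≤ D k (n + t * 2 ^ (k + 1))) :
    (Zset R (n + t * 2 ^ (k + 1))).Finite ∧
      (Zset R (n + t * 2 ^ (k + 1))).ncard + (⌊2 * R / d⌋₊ + 1) ≤
        2 ^ t * ((Zset R n).ncard + (⌊2 * R / d⌋₊ + 1)) := by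
  induction t with
  | zero => simpa using hf
  | succ t ih =>
    have e : n + (t + 1) * 2 ^ (k + 1) = n + t * 2 ^ (k + 1) + 2 ^ (k + 1) := by ring
    rw [e] at hD ⊢
    obtain ⟨f1, f2⟩ := ih (hD.trans (D_anti _ _ _ (Nat.le_add_right _ _)))
    obtain ⟨g1, g2⟩ := doubling R k _ (h.trans (by
      have := Nat.zero_le (t * 2 ^ (k + 1)); omega)) f1 d hd hD
    refine ⟨g1, ?_⟩
    have : 2 ^ (t + 1) * ((Zset R n).ncard + (⌊2 * R / d⌋₊ + 1)) =
      2 * (2 ^ t * ((Zset R n).ncard + (⌊2 * R / d⌋₊ + 1))) := by ring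
    rw [this]
    omega

def P : ℕ → ℕ
  | 0 => 1
  | K + 1 => 2 ^ (K + 3) * P K

def Q : ℕ → ℕ
  | 0 => 1
  | k + 1 => 2 ^ k * Q k

lemma P_pos (K : ℕ) : 0 < P K := by
  induction K with
  | zero => exact Nat.one_pos
  | succ K ih => rw [P]; positivity

lemma Q_pos (K : ℕ) : 0 < Q K := by
  induction K with
  | zero => exact Nat.one_pos
  | succ K ih => rw [Q]; positivity

lemma PQ (k : ℕ) : 2 ^ ((k + 2) * (k + 1)) ≤ Q k * P (k + 1) := by
  induction k with
  | zero => simp [P, Q]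
  | succ k ih =>
    rw [Q, P]
    calc 2 ^ ((k + 1 + 2) * (k + 1 + 1)) = 2 ^ k * 2 ^ (k + 1 + 3) * 2 ^ ((k + 2) * (k + 1)) := by
          rw [← pow_add, ← pow_add]; congr 1; ring
      _ ≤ 2 ^ k * 2 ^ (k + 1 + 3) * (Q k * P (k + 1)) := Nat.mul_le_mul_left _ ih
      _ = _ := by ring

lemma P_sq (K : ℕ) : P K ^ 2 = 2 ^ (K ^ 2 + 5 * K) := by
  induction K with
  | zero => simp [P]
  | succ K ih =>
    rw [P, mul_pow, ih, ← pow_mul, ← pow_add]; congr 1; ring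

lemma D_low (k n N : ℕ) (hN : n + 1 + 2 ^ k ≤ N) : (Q k : ℝ) ≤ D k n * (N : ℝ) ^ (k + 1) := by
  have hN' : (n : ℝ) + 1 + 2 ^ k ≤ N := by exact_mod_cast hN
  have gen : ∀ j, j ≤ k → (Q j : ℝ) ≤ D j n * (N : ℝ) ^ (j + 1) := by
    intro j
    induction j with
    | zero =>
      intro _
      simp only [Q, D, zero_add, pow_one, Nat.cast_one]
      rw [one_div_mul_eq_div, le_div_iff₀ (by positivity)]
      have : (0 : ℝ) < 2 ^ k := by positivity
      linarith
    | succ j ih =>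
      intro hj
      have h1 := ih (by omega)
      have h2 := D_lb j n
      have hp : (2 : ℝ) ^ j ≤ 2 ^ k := pow_le_pow_right₀ (by norm_num) (by omega)
      have hd := D_pos (j + 1) n
      have h3 : 2 ^ j * D j n ≤ N * D (j + 1) n := by
        have hj1 : (0 : ℝ) < (j : ℝ) + 1 := by positivity
        have : ((j : ℝ) + 1) * (2 ^ j * D j n) ≤ ((j : ℝ) + 1) * (N * D (j + 1) n) := by
          calc _ = ((j : ℝ) + 1) * 2 ^ j * D j n := by ring
            _ ≤ _ := h2
            _ ≤ (((j : ℝ) + 1) * N) * D (j + 1) n := by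
              apply mul_le_mul_of_nonneg_right _ hd.le
              have : (0 : ℝ) ≤ j := by positivity
              have : (0 : ℝ) ≤ n := by positivity
              nlinarith
            _ = _ := by ring
        exact le_of_mul_le_mul_left this hj1
      rw [Q]
      push_cast
      calc (2 : ℝ) ^ j * Q j ≤ 2 ^ j * (D j n * (N : ℝ) ^ (j + 1)) := by gcongr
        _ = (2 ^ j * D j n) * (N : ℝ) ^ (j + 1) := by ring
        _ ≤ (N * D (j + 1) n) * (N : ℝ) ^ (j + 1) := by gcongr
        _ = _ := by ring
  exact gen k le_rfl

noncomputable def W (K : ℕ) : ℝ := P K * ((K : ℝ) + 2) ^ K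

lemma W_pos (K : ℕ) : 0 < W K := by
  have := P_pos K
  have : (0 : ℝ) < P K := by exact_mod_cast this
  unfold W; positivity

lemma W_one_le (K : ℕ) : 1 ≤ W K := by
  have := P_pos K
  have h1 : (1 : ℝ) ≤ P K := by exact_mod_cast this
  have h2 : (1 : ℝ) ≤ ((K : ℝ) + 2) ^ K := one_le_pow₀ (by linarith [(Nat.cast_nonneg K : (0 : ℝ) ≤ K)])
  unfold W; nlinarith

lemma W_succ (K : ℕ) : 2 ^ (K + 3) * W K ≤ W (K + 1) := by
  unfold W
  rw [P]
  push_cast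
  have : ((K : ℝ) + 2) ^ K ≤ ((K : ℝ) + 1 + 2) ^ (K + 1) := by
    calc ((K : ℝ) + 2) ^ K ≤ ((K : ℝ) + 1 + 2) ^ K := by gcongr; linarith
      _ ≤ _ := pow_le_pow_right₀ (by linarith [(Nat.cast_nonneg K : (0 : ℝ) ≤ K)]) (by omega)
  rw [mul_assoc]
  gcongr

lemma inv_D_le (k : ℕ) : 1 / D k ((k + 2) * 2 ^ (k + 2)) ≤ W (k + 1) := by
  set n := (k + 2) * 2 ^ (k + 2) with hn
  have hN : n + 1 + 2 ^ k ≤ (k + 3) * 2 ^ (k + 2) := by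
    have : 1 ≤ 2 ^ k := Nat.one_le_two_pow
    rw [hn, pow_add]; nlinarith
  have h := D_low k n _ hN
  have hD := D_pos k n
  have hQ : (0 : ℝ) < Q k := by exact_mod_cast Q_pos k
  rw [div_le_iff₀ hD]
  have h2 : ((((k + 3) * 2 ^ (k + 2) : ℕ)) : ℝ) ^ (k + 1) ≤ Q k * W (k + 1) := by
    have h3 : (2 : ℝ) ^ ((k + 2) * (k + 1)) ≤ Q k * P (k + 1) := by exact_mod_cast PQ k
    unfold W
    push_cast
    rw [mul_pow, ← pow_mul]
    calc ((k : ℝ) + 3) ^ (k + 1) * 2 ^ ((k + 2) * (k + 1)) ≤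
        ((k : ℝ) + 3) ^ (k + 1) * (Q k * P (k + 1)) := by gcongr
      _ = _ := by ring
  have h4 : (Q k : ℝ) * 1 ≤ Q k * (W (k + 1) * D k n) := by
    calc (Q k : ℝ) * 1 ≤ D k n * _ := by rw [mul_one]; exact h
      _ ≤ D k n * (Q k * W (k + 1)) := by gcongr
      _ = _ := by ring
  exact le_of_mul_le_mul_left h4 hQ

lemma Z_bound (R : ℝ) (hR : 0 ≤ R) : ∃ M : ℝ, 0 < M ∧ ∀ k : ℕ,
    (Zset R ((k + 1) * 2 ^ (k + 1))).Finite ∧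
      ((Zset R ((k + 1) * 2 ^ (k + 1))).ncard : ℝ) ≤ M * W (k + 1) := by
  refine ⟨(Zset R 2).ncard + 2 * R + 1, by positivity, fun k => ?_⟩
  induction k with
  | zero =>
    have h0 : (Zset R 0).Finite := by
      have : Zset R 0 = ∅ := by
        ext p; simp [Zset]
      rw [this]; exact Set.finite_empty
    have := (doubling R 0 0 (by simp) h0 (D 0 2) (D_pos _ _) le_rfl).1
    simp only [zero_add, pow_one, one_mul] at this ⊢
    refine ⟨this, ?_⟩
    have := W_one_le 1
    nlinarith [(Nat.cast_nonneg _ : (0 : ℝ) ≤ ((Zset R 2).ncard : ℝ))]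
  | succ k ih =>
    obtain ⟨f1, f2⟩ := ih
    set d := D k ((k + 2) * 2 ^ (k + 2)) with hd
    have hd0 : 0 < d := D_pos _ _
    have e : (k + 1) * 2 ^ (k + 1) + (k + 3) * 2 ^ (k + 1) = (k + 1 + 1) * 2 ^ (k + 1 + 1) := by ring
    obtain ⟨g1, g2⟩ := doubling_iter R k ((k + 1) * 2 ^ (k + 1)) (by
      rw [pow_succ]; have := Nat.zero_le (2 ^ k); nlinarith) f1 d hd0 (k + 3) (by rw [e])
    rw [e] at g1 g2
    refine ⟨g1, ?_⟩
    have g3 : ((Zset R ((k + 1 + 1) * 2 ^ (k + 1 + 1))).ncard : ℝ) ≤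
        2 ^ (k + 3) * ((Zset R ((k + 1) * 2 ^ (k + 1))).ncard + (⌊2 * R / d⌋₊ + 1)) := by
      have : (Zset R ((k + 1 + 1) * 2 ^ (k + 1 + 1))).ncard ≤
        2 ^ (k + 3) * ((Zset R ((k + 1) * 2 ^ (k + 1))).ncard + (⌊2 * R / d⌋₊ + 1)) := by omega
      exact_mod_cast this
    have fl : (⌊2 * R / d⌋₊ : ℝ) ≤ 2 * R * W (k + 1) := by
      refine (Nat.floor_le (by positivity)).trans ?_
      have := inv_D_le k
      rw [← hd] at this
      calc 2 * R / d = 2 * R * (1 / d) := by ring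
        _ ≤ _ := by gcongr
    set M := ((Zset R 2).ncard : ℝ) + 2 * R + 1 with hM
    have w1 := W_one_le (k + 1)
    have hz : (0 : ℝ) ≤ ((Zset R 2).ncard : ℝ) := Nat.cast_nonneg _
    have hM1 : 2 * R * W (k + 1) + 1 ≤ M * W (k + 1) := by rw [hM]; nlinarith
    have hM0 : 0 ≤ M := by rw [hM]; positivity
    calc _ ≤ _ := g3
      _ ≤ (2 : ℝ) ^ (k + 3) * (M * W (k + 1) + M * W (k + 1)) := by gcongr; linarith
      _ = M * (2 ^ (k + 1 + 3) * W (k + 1)) := by ring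
      _ ≤ M * W (k + 1 + 1) := by gcongr; exact W_succ _

lemma meas_bound (R δ : ℝ) (n : ℕ) (hδ : 0 < δ) (hf : (Zset R n).Finite) :
    volume {τ : ℝ | τ ∈ Set.Icc (-R) R ∧ |τ - gSigma τ n| < δ} ≤
      ENNReal.ofReal ((((Zset R n).ncard : ℝ) + 1) * (2 * δ)) := by
  classical
  set A := hf.toFinset with hA
  set N := (Zset R n).ncard with hN
  have hcard : A.card = N := (Set.ncard_eq_toFinset_card _ hf).symm
  let c : ℝ → ℕ := fun y => (A.filter (· ≤ y)).card
  have hconst : ∀ x ∈ Set.Icc (-R) R, ∀ y ∈ Set.Icc (-R) R, x ≤ y → c x = c y →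
      gSigma x n = gSigma y n := by
    intro x hx y hy hxy hc
    apply gs_const n x y hxy
    intro p h1 h2 j hj e
    have s1 : A.filter (· ≤ x) ⊆ A.filter (· ≤ y) := by
      intro z hz
      simp only [Finset.mem_filter] at hz ⊢
      exact ⟨hz.1, hz.2.trans hxy⟩
    have e1 : A.filter (· ≤ x) = A.filter (· ≤ y) := Finset.eq_of_subset_of_card_le s1 hc.ge
    have hp : p ∈ A.filter (· ≤ y) := by
      rw [Finset.mem_filter, hA, Set.Finite.mem_toFinset]
      exact ⟨⟨⟨by linarith [hx.1], h2.trans hy.2⟩, j, hj, e⟩, h2⟩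
    rw [← e1] at hp
    exact absurd (Finset.mem_filter.1 hp).2 (not_le.2 h1)
  have hconst' : ∀ x ∈ Set.Icc (-R) R, ∀ y ∈ Set.Icc (-R) R, c x = c y →
      gSigma x n = gSigma y n := by
    intro x hx y hy hc
    rcases le_total x y with h | h
    · exact hconst x hx y hy h hc
    · exact (hconst y hy x hx h hc.symm).symm
  have hsub : {τ : ℝ | τ ∈ Set.Icc (-R) R ∧ |τ - gSigma τ n| < δ} ⊆
      ⋃ i ∈ Finset.range (N + 1), {τ : ℝ | τ ∈ Set.Icc (-R) R ∧ |τ - gSigma τ n| < δ ∧ c τ = i} := by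
    intro τ hτ
    simp only [Set.mem_iUnion]
    refine ⟨c τ, ?_, hτ.1, hτ.2, rfl⟩
    rw [Finset.mem_range, Nat.lt_succ_iff, ← hcard]
    exact Finset.card_filter_le _ _
  have hone : ∀ i, volume {τ : ℝ | τ ∈ Set.Icc (-R) R ∧ |τ - gSigma τ n| < δ ∧ c τ = i} ≤
      ENNReal.ofReal (2 * δ) := by
    intro i
    refine (Real.volume_le_diam _).trans ?_
    apply Metric.ediam_le
    rintro x ⟨h1, h2, h3⟩ y ⟨g1, g2, g3⟩
    rw [edist_dist]
    apply ENNReal.ofReal_le_ofReal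
    rw [← hconst' x h1 y g1 (h3.trans g3.symm)] at g2
    rw [Real.dist_eq, abs_le]
    rw [abs_lt] at h2 g2
    constructor <;> linarith
  calc _ ≤ _ := measure_mono hsub
    _ ≤ ∑ i ∈ Finset.range (N + 1), _ := measure_biUnion_finset_le _ _
    _ ≤ ∑ i ∈ Finset.range (N + 1), ENNReal.ofReal (2 * δ) := Finset.sum_le_sum fun i _ => hone i
    _ = _ := by
      rw [Finset.sum_const, Finset.card_range, nsmul_eq_mul,
        ENNReal.ofReal_mul (p := (N : ℝ) + 1) (by positivity)]
      congr 1
      rw [ENNReal.ofReal_add (by positivity) (by norm_num)]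
      simp

lemma log_W (K : ℕ) : Real.log (W K) = ((K : ℝ) ^ 2 + 5 * K) / 2 * Real.log 2 + K * Real.log (K + 2) := by
  have hP : (0 : ℝ) < P K := by exact_mod_cast P_pos K
  have h := P_sq K
  have h2 : ((P K : ℝ)) ^ 2 = 2 ^ (K ^ 2 + 5 * K) := by exact_mod_cast h
  have h3 := congrArg Real.log h2
  rw [Real.log_pow, Real.log_pow] at h3
  push_cast at h3
  unfold W
  rw [Real.log_mul hP.ne' (by positivity), Real.log_pow]
  linarith

lemma exists_K (n : ℕ) (hn : 2 ≤ n) : ∃ k, (k + 1) * 2 ^ (k + 1) ≤ n ∧ n ≤ (k + 2) * 2 ^ (k + 2) := by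
  classical
  have ex : ∃ k, n ≤ (k + 2) * 2 ^ (k + 2) := ⟨n, by
    have : 1 ≤ 2 ^ (n + 2) := Nat.one_le_two_pow
    nlinarith⟩
  refine ⟨Nat.find ex, ?_, Nat.find_spec ex⟩
  rcases h : Nat.find ex with _ | j
  · simpa using hn
  · have := Nat.find_min ex (m := j) (by omega)
    push Not at this
    exact this.le

lemma real_asymp (C ε l : ℝ) (hε : 0 < ε) (hl : 0 < l) : ∀ᶠ y : ℝ in atTop,
    C + ((y + 1) ^ 2 + 5 * (y + 1)) / 2 * l + (y + 1) * Real.log (y + 3) + 2 * l * y ≤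
      l / 2 * y ^ 2 + ε * l ^ 2 * y ^ 2 := by
  set c := ε * l ^ 2 / 16 with hc
  have hc0 : 0 < c := by positivity
  have h1 : ∀ᶠ z : ℝ in atTop, Real.log z ≤ c * z := by
    have := Real.isLittleO_log_id_atTop.bound hc0
    filter_upwards [this, eventually_ge_atTop 1] with z hz h1
    simp only [id, Real.norm_eq_abs] at hz
    rw [abs_of_nonneg (Real.log_nonneg h1), abs_of_nonneg (by linarith : 0 ≤ z)] at hz
    exact hz
  have h2 : ∀ᶠ y : ℝ in atTop, Real.log (y + 3) ≤ c * (y + 3) :=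
    (tendsto_atTop_add_const_right atTop (3 : ℝ) tendsto_id).eventually h1
  set A := |C| + 8 * l with hA
  have hA0 : 0 ≤ A := by positivity
  filter_upwards [h2, eventually_ge_atTop 3, eventually_ge_atTop (A / (4 * c))] with y hy y3 yA
  rw [div_le_iff₀ (by positivity)] at yA
  have hC := le_abs_self C
  have e1 : (y + 1) * Real.log (y + 3) ≤ (y + 1) * (c * (y + 3)) := by gcongr
  have e2 : (y + 1) * (c * (y + 3)) ≤ c * (4 * y ^ 2) := by
    rw [show (y + 1) * (c * (y + 3)) = c * ((y + 1) * (y + 3)) by ring]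
    apply mul_le_mul_of_nonneg_left _ hc0.le
    nlinarith
  have e3 : A * y ≤ 4 * c * y ^ 2 := by nlinarith
  have e4 : ε * l ^ 2 * y ^ 2 = 16 * c * y ^ 2 := by rw [hc]; ring
  have e5 : C ≤ |C| * y := by nlinarith [abs_nonneg C]
  have e6 : l ≤ l * y / 3 := by nlinarith
  rw [e4]
  have e7 : 0 ≤ c * y ^ 2 := by positivity
  have e8 : A * y = |C| * y + 8 * (l * y) := by rw [hA]; ring
  nlinarith

lemma low_asymp (R ε : ℝ) (hR : 0 ≤ R) (hε : 0 < ε) : ∀ᶠ n : ℕ in atTop, (Zset R n).Finite ∧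
    (((Zset R n).ncard : ℝ) + 1) * (2 * Real.exp (-(1 / Real.log 4 + ε) * (Real.log n) ^ 2)) ≤
      1 / (n : ℝ) ^ 2 := by
  obtain ⟨M, hM, hZ⟩ := Z_bound R hR
  set l := Real.log 2 with hl
  have hl0 : 0 < l := Real.log_pos (by norm_num)
  have hl4 : Real.log 4 = 2 * l := by
    rw [show (4 : ℝ) = 2 ^ 2 by norm_num, Real.log_pow, hl]; norm_num
  have ht : Tendsto (fun n : ℕ => Real.log n / l) atTop atTop :=
    (Real.tendsto_log_atTop.comp tendsto_natCast_atTop_atTop).atTop_div_const hl0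
  filter_upwards [ht.eventually (real_asymp (Real.log (2 * (M + 1))) ε l hε hl0),
    eventually_ge_atTop 2] with n hn n2
  obtain ⟨k, hk1, hk2⟩ := exists_K n n2
  obtain ⟨z1, z2⟩ := hZ (k + 1)
  have hsub := Zset_mono R hk2
  refine ⟨z1.subset hsub, ?_⟩
  have hc : ((Zset R n).ncard : ℝ) ≤ M * W (k + 2) :=
    le_trans (by exact_mod_cast Set.ncard_le_ncard hsub z1) z2
  have hn0 : (0 : ℝ) < n := by positivity
  set y := Real.log n / l with hy
  have hyl : Real.log n = y * l := by rw [hy]; field_simp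
  have hky : (k : ℝ) + 1 ≤ y := by
    rw [hy, le_div_iff₀ hl0, hl]
    have : (2 : ℝ) ^ (k + 1) ≤ n := by
      have : 2 ^ (k + 1) ≤ n := le_trans (Nat.le_mul_of_pos_left _ (by omega)) hk1
      exact_mod_cast this
    have := Real.log_le_log (by positivity) this
    rw [Real.log_pow] at this
    push_cast at this
    exact this
  have hk0 : (0 : ℝ) ≤ k := by positivity
  have w1 := W_one_le (k + 2)
  have hW : Real.log (W (k + 2)) ≤ ((y + 1) ^ 2 + 5 * (y + 1)) / 2 * l + (y + 1) * Real.log (y + 3) := by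
    rw [log_W]
    push_cast
    have a1 : (k : ℝ) + 2 ≤ y + 1 := by linarith
    have a2 : Real.log ((k : ℝ) + 2 + 2) ≤ Real.log (y + 3) := Real.log_le_log (by positivity) (by linarith)
    have a3 : 0 ≤ Real.log ((k : ℝ) + 2 + 2) := Real.log_nonneg (by linarith)
    gcongr
  have step : (((Zset R n).ncard : ℝ) + 1) * (2 * Real.exp (-(1 / Real.log 4 + ε) * (Real.log n) ^ 2))
      ≤ (2 * (M + 1)) * W (k + 2) * Real.exp (-(1 / Real.log 4 + ε) * (Real.log n) ^ 2) := by
    have : ((Zset R n).ncard : ℝ) + 1 ≤ (M + 1) * W (k + 2) := by nlinarith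
    calc _ ≤ ((M + 1) * W (k + 2)) * (2 * Real.exp (-(1 / Real.log 4 + ε) * (Real.log n) ^ 2)) := by gcongr
      _ = _ := by ring
  refine step.trans ?_
  have e1 : (1 : ℝ) / (n : ℝ) ^ 2 = Real.exp (-(2 * Real.log n)) := by
    rw [Real.exp_neg, show 2 * Real.log n = Real.log ((n : ℝ) ^ 2) by rw [Real.log_pow]; norm_num,
      Real.exp_log (by positivity), one_div]
  rw [e1, ← Real.exp_log (show 0 < 2 * (M + 1) by positivity), ← Real.exp_log (W_pos (k + 2)),
    ← Real.exp_add, ← Real.exp_add, Real.exp_le_exp, hl4, hyl]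
  have e2 : -(1 / (2 * l) + ε) * (y * l) ^ 2 = -(l / 2 * y ^ 2 + ε * l ^ 2 * y ^ 2) := by
    field_simp
  rw [e2]
  linarith

lemma lower_R (R ε : ℝ) (hR : 0 ≤ R) (hε : 0 < ε) : ∀ᵐ τ : ℝ, τ ∈ Set.Icc (-R) R →
    ∀ᶠ n : ℕ in atTop, Real.exp (-(1 / Real.log 4 + ε) * (Real.log n) ^ 2) ≤ |τ - gSigma τ n| := by
  obtain ⟨N, hN⟩ := eventually_atTop.1 (low_asymp R ε hR hε)
  set δ : ℕ → ℝ := fun n => Real.exp (-(1 / Real.log 4 + ε) * (Real.log n) ^ 2) with hδ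
  let s : ℕ → Set ℝ := fun n => {τ : ℝ | τ ∈ Set.Icc (-R) R ∧ |τ - gSigma τ (n + N)| < δ (n + N)}
  have hs : ∀ n, volume (s n) ≤ ENNReal.ofReal (1 / ((n + N : ℕ) : ℝ) ^ 2) := by
    intro n
    obtain ⟨f, b⟩ := hN (n + N) (by omega)
    exact (meas_bound R _ (n + N) (Real.exp_pos _) f).trans (ENNReal.ofReal_le_ofReal b)
  have hsum : (∑' n, volume (s n)) ≠ ⊤ := by
    have h1 : Summable fun n : ℕ => 1 / ((n + N : ℕ) : ℝ) ^ 2 :=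
      (summable_nat_add_iff N).2 (Real.summable_one_div_nat_pow.2 (by norm_num))
    exact ne_top_of_le_ne_top h1.tsum_ofReal_ne_top (ENNReal.tsum_le_tsum hs)
  filter_upwards [ae_eventually_notMem hsum] with τ hτ hR'
  obtain ⟨N', hN'⟩ := eventually_atTop.1 hτ
  filter_upwards [eventually_ge_atTop (N + N')] with n hn
  have := hN' (n - N) (by omega)
  by_contra hc
  apply this
  refine ⟨hR', ?_⟩
  rw [Nat.sub_add_cancel (by omega)]
  exact not_le.1 hc

lemma lower_part : ∀ᵐ τ : ℝ, ∀ i : ℕ, ∀ᶠ n : ℕ in atTop,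
    Real.exp (-(1 / Real.log 4 + 1 / ((i : ℝ) + 1)) * (Real.log n) ^ 2) ≤ |τ - gSigma τ n| := by
  have h : ∀ᵐ τ : ℝ, ∀ i : ℕ, ∀ r : ℕ, τ ∈ Set.Icc (-(r : ℝ)) r → ∀ᶠ n : ℕ in atTop,
      Real.exp (-(1 / Real.log 4 + 1 / ((i : ℝ) + 1)) * (Real.log n) ^ 2) ≤ |τ - gSigma τ n| := by
    rw [ae_all_iff]; intro i
    rw [ae_all_iff]; intro r
    exact lower_R r _ (by positivity) (by positivity)
  filter_upwards [h] with τ hτ i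
  obtain ⟨r, hr⟩ := exists_nat_ge |τ|
  exact hτ i r (abs_le.1 hr)

lemma F_cont (n j : ℕ) : Continuous (F n j) := by
  induction j with
  | zero => exact continuous_id
  | succ j ih =>
    show Continuous fun u => |F n j u - 1 / ((n : ℝ) + j + 1)|
    fun_prop

def Bad (δ : ℕ → ℝ) (n : ℕ) : Set ℝ := {u | ∀ j, δ (n + j) < F n j u}

lemma Bad_meas (δ : ℕ → ℝ) (n : ℕ) : MeasurableSet (Bad δ n) := by
  have : Bad δ n = ⋂ j, {u | δ (n + j) < F n j u} := by
    ext u; simp [Bad]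
  rw [this]
  exact MeasurableSet.iInter fun j => measurableSet_lt measurable_const (F_cont n j).measurable

lemma Bad_F (δ : ℕ → ℝ) (n i : ℕ) (u : ℝ) (h : u ∈ Bad δ n) : F n i u ∈ Bad δ (n + i) := by
  intro j
  rw [← F_add, add_assoc]
  exact h (i + j)

noncomputable def b (δ : ℕ → ℝ) (k n : ℕ) : ℝ :=
  volume.real (Bad δ (n + 2 ^ k) ∩ Set.Icc 0 (D k n))

lemma b_nonneg (δ : ℕ → ℝ) (k n : ℕ) : 0 ≤ b δ k n := measureReal_nonneg

lemma b_fin (δ : ℕ → ℝ) (k n : ℕ) : volume (Bad δ (n + 2 ^ k) ∩ Set.Icc 0 (D k n)) ≠ ⊤ :=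
  ne_top_of_le_ne_top (by simp) (measure_mono Set.inter_subset_right)

lemma b_le (δ : ℕ → ℝ) (k n : ℕ) : b δ k n ≤ D k n := by
  have h : b δ k n ≤ volume.real (Set.Icc 0 (D k n)) :=
    measureReal_mono Set.inter_subset_right (by simp)
  rw [Real.volume_real_Icc_of_le (D_nonneg k n)] at h
  linarith

lemma b_zero (δ : ℕ → ℝ) (k n : ℕ) (h : D k n ≤ δ (n + 2 ^ k)) : b δ k n = 0 := by
  have : Bad δ (n + 2 ^ k) ∩ Set.Icc 0 (D k n) = ∅ := by
    ext u
    simp only [Set.mem_inter_iff, Set.mem_empty_iff_false, iff_false]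
    rintro ⟨h1, h2⟩
    have := h1 0
    simp only [F, add_zero] at this
    linarith [h2.2]
  rw [b, this]; simp

lemma b_rec (δ : ℕ → ℝ) (k n : ℕ) (h : 3 * k * 2 ^ k ≤ 2 * (n + 1)) :
    b δ k n ≤ b δ k (n + 2 ^ k) + b δ (k + 1) n := by
  set d := D k (n + 2 ^ k) with hd
  set S1 := Bad δ (n + 2 ^ k + 2 ^ k) ∩ Set.Icc 0 (D k (n + 2 ^ k)) with hS1
  set S2 := Bad δ (n + 2 ^ (k + 1)) ∩ Set.Icc 0 (D (k + 1) n) with hS2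
  have e2 : n + 2 ^ k + 2 ^ k = n + 2 ^ (k + 1) := by ring
  have hDk : D (k + 1) n = D k n - d := by rw [D]
  have sub : Bad δ (n + 2 ^ k) ∩ Set.Icc 0 (D k n) ⊆
      (fun x => d - x) ⁻¹' S1 ∪ (fun x => x + -d) ⁻¹' S2 := by
    rintro u ⟨h1, h2⟩
    have g := Bad_F δ _ (2 ^ k) u h1
    rw [E k n h u h2.1 h2.2, ← hd] at g
    rcases le_total u d with hu | hu
    · left
      rw [abs_of_nonneg (by linarith)] at g
      exact ⟨g, by constructor <;> linarith [h2.1]⟩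
    · right
      rw [abs_of_nonpos (by linarith), e2] at g
      refine ⟨?_, ?_⟩
      · have : u + -d = -(d - u) := by ring
        simp only [this]; exact g
      · rw [hDk]
        constructor <;> simp only [] <;> linarith [h2.2]
  have mS1 : MeasurableSet S1 := (Bad_meas _ _).inter measurableSet_Icc
  have v1 : volume ((fun x => d - x) ⁻¹' S1) = volume S1 :=
    (Measure.measurePreserving_sub_left volume d).measure_preimage mS1.nullMeasurableSet
  have v2 : volume ((fun x => x + -d) ⁻¹' S2) = volume S2 := measure_preimage_add_right volume (-d) S2
  have f1 : volume S1 ≠ ⊤ := b_fin δ k (n + 2 ^ k)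
  have f2 : volume S2 ≠ ⊤ := b_fin δ (k + 1) n
  have : volume (Bad δ (n + 2 ^ k) ∩ Set.Icc 0 (D k n)) ≤ volume S1 + volume S2 := by
    refine (measure_mono sub).trans ((measure_union_le _ _).trans ?_)
    rw [v1, v2]
  have := ENNReal.toReal_mono (ENNReal.add_ne_top.2 ⟨f1, f2⟩) this
  rw [ENNReal.toReal_add f1 f2] at this
  exact this

noncomputable def hh (k n : ℕ) : ℝ := n * D k n / 2 ^ k

lemma hh_super (k n : ℕ) (hk : 2 ≤ k) (hn : 2 ≤ n) : hh k (n + 2 ^ k) + hh (k + 1) n ≤ hh k n := by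
  unfold hh
  have e : D k (n + 2 ^ k) = D k n - D (k + 1) n := by rw [D]; ring
  rw [e]
  have lb := D_lb k n
  have hp := D_pos (k + 1) n
  have hk' : (2 : ℝ) ≤ k := by exact_mod_cast hk
  have hn' : (2 : ℝ) ≤ n := by exact_mod_cast hn
  have hq : (0 : ℝ) < 2 ^ k := by positivity
  push_cast
  rw [pow_succ]
  set q : ℝ := 2 ^ k
  set X := D k n
  set Y := D (k + 1) n
  have key : q * X ≤ ((n : ℝ) / 2 + q) * Y := by
    have h1 : ((k : ℝ) + 1) * (q * X) ≤ ((k : ℝ) + 1) * (((n : ℝ) / 2 + q) * Y) := by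
      calc _ = ((k : ℝ) + 1) * q * X := by ring
        _ ≤ _ := lb
        _ ≤ (((k : ℝ) + 1) * ((n : ℝ) / 2 + q)) * Y := by
          apply mul_le_mul_of_nonneg_right _ hp.le
          nlinarith
        _ = _ := by ring
    exact le_of_mul_le_mul_left h1 (by linarith)
  rw [show ((n : ℝ) + q) * (X - Y) / q + n * Y / (q * 2) = (((n : ℝ) + q) * (X - Y) + n * Y / 2) / q by
    field_simp]
  apply div_le_div_of_nonneg_right _ hq.le
  nlinarith

lemma D_le_inv (k n : ℕ) : D k n ≤ 1 / ((n : ℝ) + 1) := by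
  induction k with
  | zero => exact le_rfl
  | succ k ih => exact (D_anti_k k n).trans ih

lemma b_down (δ : ℕ → ℝ) (k N0 : ℕ) (hc : ∀ n, N0 ≤ n → 3 * k * 2 ^ k ≤ 2 * (n + 1))
    (h : ∀ n, N0 ≤ n → b δ (k + 1) n = 0) (n : ℕ) (hn : N0 ≤ n) : b δ k n = 0 := by
  have it : ∀ t : ℕ, b δ k n ≤ b δ k (n + t * 2 ^ k) := by
    intro t
    induction t with
    | zero => simp
    | succ t ih =>
      have hge : N0 ≤ n + t * 2 ^ k := hn.trans (Nat.le_add_right _ _)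
      have := b_rec δ k (n + t * 2 ^ k) (hc _ hge)
      rw [h _ hge, add_zero] at this
      rw [show n + (t + 1) * 2 ^ k = n + t * 2 ^ k + 2 ^ k by ring]
      exact ih.trans this
  apply le_antisymm _ (b_nonneg _ _ _)
  refine ge_of_tendsto' (x := atTop) tendsto_one_div_add_atTop_nhds_zero_nat fun t : ℕ => ?_
  refine (it t).trans ((b_le _ _ _).trans ((D_le_inv _ _).trans ?_))
  apply one_div_le_one_div_of_le (by positivity)
  have : t ≤ n + t * 2 ^ k := by
    have := Nat.le_mul_of_pos_right t (Nat.two_pow_pos k)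
    omega
  have : (t : ℝ) ≤ ((n + t * 2 ^ k : ℕ) : ℝ) := by exact_mod_cast this
  linarith

lemma b_super (δ : ℕ → ℝ) (kk : ℕ → ℕ) (N0 : ℕ) (hN0 : 2 ≤ N0) (hmono : Monotone kk)
    (h3 : ∀ n, N0 ≤ n → 3 * kk n * 2 ^ kk n ≤ 2 * (n + 1))
    (h4 : ∀ n, N0 ≤ n → D (kk n) n ≤ δ (n + 2 ^ kk n))
    (η : ℝ) (N : ℕ) (h5 : ∀ n, N ≤ n → N0 ≤ n → (2 : ℝ) ^ kk n ≤ η * n) (hη : 0 < η) :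
    ∀ t n, N0 ≤ n → N ≤ n + t → ∀ s k, 2 ≤ k → kk n = k + s → b δ k n ≤ η * hh k n := by
  intro t
  induction t with
  | zero =>
    intro n hn hN s k hk hs
    have h := h5 n (by omega) hn
    have hp : (2 : ℝ) ^ k ≤ 2 ^ kk n := pow_le_pow_right₀ (by norm_num) (by omega)
    refine (b_le _ _ _).trans ?_
    unfold hh
    rw [← mul_div_assoc, le_div_iff₀ (by positivity)]
    calc D k n * 2 ^ k ≤ D k n * (η * n) :=
          mul_le_mul_of_nonneg_left (hp.trans h) (D_nonneg _ _)
      _ = _ := by ring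
  | succ t iht =>
    intro n hn hN s
    induction s with
    | zero =>
      intro k hk hs
      have := h4 n hn
      rw [hs, add_zero] at this
      rw [b_zero δ k n this]
      have := D_nonneg k n
      unfold hh; positivity
    | succ s ihs =>
      intro k hk hs
      have hc : 3 * k * 2 ^ k ≤ 2 * (n + 1) := by
        refine le_trans ?_ (h3 n hn)
        exact Nat.mul_le_mul (by omega) (Nat.pow_le_pow_right (by norm_num) (by omega))
      have r := b_rec δ k n hc
      have r1 := ihs (k + 1) (by omega) (by omega)
      have hm : kk n ≤ kk (n + 2 ^ k) := hmono (Nat.le_add_right _ _)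
      have hpos := Nat.two_pow_pos k
      have r2 := iht (n + 2 ^ k) (by omega) (by omega) (kk (n + 2 ^ k) - k) k hk (by omega)
      have r3 := hh_super k n hk (by omega)
      nlinarith

lemma b_null (δ : ℕ → ℝ) (kk : ℕ → ℕ) (N0 : ℕ) (hN0 : 2 ≤ N0) (hmono : Monotone kk)
    (h2 : ∀ n, N0 ≤ n → 2 ≤ kk n)
    (h3 : ∀ n, N0 ≤ n → 3 * kk n * 2 ^ kk n ≤ 2 * (n + 1))
    (h4 : ∀ n, N0 ≤ n → D (kk n) n ≤ δ (n + 2 ^ kk n))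
    (h5 : ∀ η : ℝ, 0 < η → ∃ N, ∀ n, N ≤ n → (2 : ℝ) ^ kk n ≤ η * n) (n : ℕ) (hn : N0 ≤ n) :
    b δ 0 n = 0 := by
  have z2 : ∀ n, N0 ≤ n → b δ 2 n = 0 := by
    intro n hn
    apply le_antisymm _ (b_nonneg _ _ _)
    by_contra hc
    push Not at hc
    have hp : 0 ≤ hh 2 n := by have := D_nonneg 2 n; unfold hh; positivity
    set η := b δ 2 n / (2 * (hh 2 n + 1)) with hη
    have hη0 : 0 < η := by positivity
    obtain ⟨N, hN⟩ := h5 η hη0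
    have := b_super δ kk N0 hN0 hmono h3 h4 η N (fun n h _ => hN n h) hη0 N n hn (by omega)
      (kk n - 2) 2 le_rfl (by have := h2 n hn; omega)
    have e : η * (2 * (hh 2 n + 1)) = b δ 2 n := by rw [hη]; field_simp
    nlinarith
  have z1 := b_down δ 1 N0 (fun n hn => by omega) z2
  exact b_down δ 0 N0 (fun n hn => by omega) z1 n hn

lemma small (τ : ℝ) : ∃ n0, ∀ n, n0 ≤ n → |τ - gSigma τ (n + 1)| ≤ 1 / ((n : ℝ) + 1) := by
  have ex : ∃ n0 : ℕ, |τ - gSigma τ (n0 + 1)| ≤ 1 / ((n0 : ℝ) + 1) := by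
    by_contra hc
    push Not at hc
    have inv : ∀ n : ℕ, |τ - gSigma τ (n + 1)| + ∑ i ∈ Finset.range (n + 1), 1 / ((i : ℝ) + 1)
        = |τ - gSigma τ 1| + 1 := by
      intro n
      induction n with
      | zero => simp
      | succ n ih =>
        rw [Finset.sum_range_succ, gs, abs_of_nonneg, ← ih]
        · push_cast; ring
        · have := hc n
          have h2 : 1 / (((n + 1 : ℕ) : ℝ) + 1) ≤ 1 / ((n : ℝ) + 1) := by
            apply one_div_le_one_div_of_le (by positivity); push_cast; linarith
          linarith
    have ht := Real.tendsto_sum_range_one_div_nat_succ_atTop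
    obtain ⟨N, hN⟩ := (ht.eventually_gt_atTop (|τ - gSigma τ 1| + 1)).and (eventually_ge_atTop 1) |>.exists
    have := inv (N - 1)
    rw [Nat.sub_add_cancel hN.2] at this
    have h3 := abs_nonneg (τ - gSigma τ N)
    linarith [hN.1]
  obtain ⟨n0, h0⟩ := ex
  refine ⟨n0, fun n hn => ?_⟩
  induction n, hn using Nat.le_induction with
  | base => exact h0
  | succ n hn ih =>
    rw [gs, abs_le]
    push_cast
    have hp : (0 : ℝ) < (n : ℝ) + 1 := by positivity
    have h1 : 1 / ((n : ℝ) + 1) ≤ 2 * (1 / ((n : ℝ) + 1 + 1)) := by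
      rw [div_le_iff₀ hp]
      rw [show 2 * (1 / ((n : ℝ) + 1 + 1)) * ((n : ℝ) + 1) = (2 * ((n : ℝ) + 1)) / ((n : ℝ) + 1 + 1) by ring]
      rw [le_div_iff₀ (by positivity)]
      linarith [(Nat.cast_nonneg n : (0 : ℝ) ≤ n)]
    have := abs_nonneg (τ - gSigma τ (n + 1))
    constructor <;> linarith

lemma gs_rat (τ : ℝ) (n : ℕ) : ∃ q : ℚ, gSigma τ n = q := by
  induction n with
  | zero => exact ⟨0, by simp [gSigma]⟩
  | succ n ih =>
    obtain ⟨q, hq⟩ := ih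
    rw [gSigma]
    split_ifs
    · exact ⟨q + 1 / (n + 1), by rw [hq]; push_cast; ring⟩
    · exact ⟨q + -1 / (n + 1), by rw [hq]; push_cast; ring⟩

lemma null_pull (A : Set ℝ) (hA : volume A = 0) (n : ℕ) : ∀ᵐ τ : ℝ, |τ - gSigma τ n| ∉ A := by
  have h : ∀ q : ℚ, ∀ᵐ τ : ℝ, |τ - q| ∉ A := by
    intro q
    have e1 : volume ((fun x : ℝ => x + -(q : ℝ)) ⁻¹' A) = 0 := by
      rw [measure_preimage_add_right]; exact hA
    have e2 : volume ((fun x : ℝ => (q : ℝ) - x) ⁻¹' A) = 0 :=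
      (Measure.measurePreserving_sub_left volume (q : ℝ)).quasiMeasurePreserving.preimage_null hA
    filter_upwards [compl_mem_ae_iff.2 e1, compl_mem_ae_iff.2 e2] with τ a1 a2 h
    rcases abs_choice (τ - q) with h1 | h1
    · rw [h1] at h; exact a1 h
    · rw [h1] at h; apply a2
      show (q : ℝ) - τ ∈ A
      rwa [neg_sub] at h
  filter_upwards [ae_all_iff.2 h] with τ hτ
  obtain ⟨q, hq⟩ := gs_rat τ n
  rw [hq]; exact hτ q

lemma upper_of_null (δ : ℕ → ℝ) (N0 : ℕ) (h : ∀ n, N0 ≤ n → b δ 0 n = 0) :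
    ∀ᵐ τ : ℝ, ∃ᶠ n : ℕ in atTop, |τ - gSigma τ n| ≤ δ n := by
  have h1 : ∀ᵐ τ : ℝ, ∀ n, N0 ≤ n →
      |τ - gSigma τ (n + 1)| ∉ Bad δ (n + 1) ∩ Set.Icc 0 (D 0 n) := by
    rw [ae_all_iff]; intro n
    by_cases hn : N0 ≤ n
    · have z := h n hn
      unfold b at z
      rw [measureReal_def, ENNReal.toReal_eq_zero_iff] at z
      have z' := z.resolve_right (b_fin δ 0 n)
      filter_upwards [null_pull _ z' (n + 1)] with τ hτ _
      exact hτ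
    · exact Eventually.of_forall fun τ hh => absurd hh hn
  filter_upwards [h1] with τ hτ
  obtain ⟨n0, hn0⟩ := small τ
  rw [frequently_atTop]
  intro a
  set n := max a (max N0 n0) with hn
  have hc := hτ n (by omega)
  have hbad : |τ - gSigma τ (n + 1)| ∉ Bad δ (n + 1) := by
    intro hb
    exact hc ⟨hb, abs_nonneg _, hn0 n (by omega)⟩
  simp only [Bad, Set.mem_ofPred_eq, not_forall, not_lt] at hbad
  obtain ⟨j, hj⟩ := hbad
  rw [← gs_F] at hj
  exact ⟨n + 1 + j, by omega, hj⟩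

lemma D_up (k n : ℕ) : D k n * ((n : ℝ) + 1) ^ (k + 1) ≤ (k : ℝ) ^ k * Q k := by
  induction k with
  | zero =>
    simp only [D, Q]
    have : (0 : ℝ) < (n : ℝ) + 1 := by positivity
    field_simp
    simp
  | succ k ih =>
    have h := D_ub k n
    rw [Q]
    push_cast
    have hk : (k : ℝ) ^ k ≤ ((k : ℝ) + 1) ^ k := by gcongr; linarith
    calc D (k + 1) n * ((n : ℝ) + 1) ^ (k + 1 + 1)
        = (((n : ℝ) + 1) * D (k + 1) n) * ((n : ℝ) + 1) ^ (k + 1) := by ring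
      _ ≤ (((k : ℝ) + 1) * 2 ^ k * D k n) * ((n : ℝ) + 1) ^ (k + 1) := by gcongr
      _ = ((k : ℝ) + 1) * 2 ^ k * (D k n * ((n : ℝ) + 1) ^ (k + 1)) := by ring
      _ ≤ ((k : ℝ) + 1) * 2 ^ k * ((k : ℝ) ^ k * Q k) := by gcongr
      _ ≤ ((k : ℝ) + 1) * 2 ^ k * (((k : ℝ) + 1) ^ k * Q k) := by gcongr
      _ = _ := by ring

lemma Q_sq (k : ℕ) : Q k ^ 2 * 2 ^ k = 2 ^ (k ^ 2) := by
  induction k with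
  | zero => simp [Q]
  | succ k ih =>
    rw [Q]
    calc (2 ^ k * Q k) ^ 2 * 2 ^ (k + 1) = 2 ^ k * 2 ^ k * 2 * (Q k ^ 2 * 2 ^ k) := by ring
      _ = _ := by rw [ih]; ring

lemma log_Q (k : ℕ) : Real.log (Q k) ≤ (k : ℝ) ^ 2 / 2 * Real.log 2 := by
  have hQ : (0 : ℝ) < Q k := by exact_mod_cast Q_pos k
  have h : (Q k : ℝ) ^ 2 * 2 ^ k = 2 ^ (k ^ 2) := by exact_mod_cast Q_sq k
  have h2 := congrArg Real.log h
  rw [Real.log_mul (by positivity) (by positivity), Real.log_pow, Real.log_pow, Real.log_pow] at h2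
  push_cast at h2
  have : 0 ≤ (k : ℝ) * Real.log 2 := by positivity
  linarith

lemma log_D (k n : ℕ) (hk : 1 ≤ k) : Real.log (D k n) ≤
    k * Real.log k + (k : ℝ) ^ 2 / 2 * Real.log 2 - ((k : ℝ) + 1) * Real.log ((n : ℝ) + 1) := by
  have hQ : (0 : ℝ) < Q k := by exact_mod_cast Q_pos k
  have hk' : (0 : ℝ) < k := by exact_mod_cast hk
  have hD := D_pos k n
  have h := Real.log_le_log (by positivity) (D_up k n)
  rw [Real.log_mul hD.ne' (by positivity), Real.log_mul (by positivity) hQ.ne', Real.log_pow,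
    Real.log_pow] at h
  push_cast at h
  have := log_Q k
  linarith

noncomputable def kk (κ : ℝ) (n : ℕ) : ℕ := ⌊κ * (Real.log n / Real.log 2)⌋₊

lemma kk_mono (κ : ℝ) (hκ : 0 ≤ κ) : Monotone (kk κ) := by
  intro n m h
  apply Nat.floor_le_floor
  have : Real.log n ≤ Real.log m := by
    rcases Nat.eq_zero_or_pos n with rfl | hn
    · simp only [Nat.cast_zero, Real.log_zero]; exact Real.log_natCast_nonneg m
    · exact Real.log_le_log (by exact_mod_cast hn) (by exact_mod_cast h)
  have hl : 0 < Real.log 2 := Real.log_pos (by norm_num)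
  gcongr

lemma real_asymp2 (ε l lam : ℝ) (hε : 0 < ε) (hl : 0 < l) (hlam : lam ^ 2 ≤ ε * l) :
    ∀ᶠ y : ℝ in atTop, y * Real.log y + l * lam ^ 2 / 2 * y ^ 2 + l / 2 * (2 * y + 1) ≤
      ε * l ^ 2 * y ^ 2 := by
  set c := ε * l ^ 2 / 4 with hc
  have hc0 : 0 < c := by positivity
  have h1 : ∀ᶠ z : ℝ in atTop, Real.log z ≤ c * z := by
    have := Real.isLittleO_log_id_atTop.bound hc0
    filter_upwards [this, eventually_ge_atTop 1] with z hz h1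
    simp only [id, Real.norm_eq_abs] at hz
    rw [abs_of_nonneg (Real.log_nonneg h1), abs_of_nonneg (by linarith : 0 ≤ z)] at hz
    exact hz
  filter_upwards [h1, eventually_ge_atTop 1, eventually_ge_atTop (2 * l / c)] with y hy y1 y2
  rw [div_le_iff₀ hc0] at y2
  have e1 : y * Real.log y ≤ y * (c * y) := by gcongr
  have e2 : l * lam ^ 2 / 2 * y ^ 2 ≤ l * (ε * l) / 2 * y ^ 2 := by gcongr
  have e3 : l * (ε * l) / 2 * y ^ 2 = 2 * c * y ^ 2 := by rw [hc]; ring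
  have e4 : ε * l ^ 2 * y ^ 2 = 4 * c * y ^ 2 := by rw [hc]; ring
  have e5 : 2 * l * y ≤ y * c * y := by gcongr
  nlinarith

set_option maxHeartbeats 800000 in
lemma upper_eps (ε : ℝ) (hε : 0 < ε) (hε2 : ε ≤ 1 / 2) : ∀ᵐ τ : ℝ, ∃ᶠ n : ℕ in atTop,
    |τ - gSigma τ n| ≤ Real.exp (-(1 / Real.log 4 - ε) * (Real.log n) ^ 2) := by
  set δ : ℕ → ℝ := fun n => Real.exp (-(1 / Real.log 4 - ε) * (Real.log n) ^ 2) with hδ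
  set l := Real.log 2 with hl
  have hl0 : 0 < l := Real.log_pos (by norm_num)
  have hl1 : 1 / 2 < l := by have := Real.log_two_gt_d9; rw [hl]; linarith
  have hl2 : l < 1 := by have := Real.log_two_lt_d9; rw [hl]; linarith
  have hl4 : Real.log 4 = 2 * l := by
    rw [show (4 : ℝ) = 2 ^ 2 by norm_num, Real.log_pow, hl]; norm_num
  set lam := ε / 2 with hlam
  have hlam0 : 0 < lam := by positivity
  set κ := 1 - lam with hκ
  have hκ0 : 1 / 2 < κ := by rw [hκ, hlam]; linarith
  have hκ1 : κ < 1 := by rw [hκ]; linarith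
  have ht : Tendsto (fun n : ℕ => Real.log n / l) atTop atTop :=
    (Real.tendsto_log_atTop.comp tendsto_natCast_atTop_atTop).atTop_div_const hl0
  have hpow : ∀ n : ℕ, 1 ≤ n → (2 : ℝ) ^ kk κ n ≤ n * Real.exp (-(lam * l * (Real.log n / l))) := by
    intro n hn
    have hn0 : (0 : ℝ) < n := by exact_mod_cast hn
    have hlog : 0 ≤ Real.log n := Real.log_natCast_nonneg n
    have hk : (kk κ n : ℝ) ≤ κ * (Real.log n / l) := Nat.floor_le (by positivity)
    have e1 : (2 : ℝ) ^ kk κ n = Real.exp (kk κ n * l) := by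
      rw [hl, mul_comm, Real.exp_mul, Real.exp_log (by norm_num), Real.rpow_natCast]
    have e2 : (n : ℝ) * Real.exp (-(lam * l * (Real.log n / l))) =
        Real.exp (κ * (Real.log n / l) * l) := by
      rw [← Real.exp_log hn0, ← Real.exp_add, Real.log_exp]
      congr 1
      rw [hκ]; field_simp; ring
    rw [e1, e2, Real.exp_le_exp]
    gcongr
  have key : ∀ᶠ n : ℕ in atTop, 2 ≤ n ∧ 2 ≤ kk κ n ∧ 3 * kk κ n * 2 ^ kk κ n ≤ 2 * (n + 1) ∧
      D (kk κ n) n ≤ δ (n + 2 ^ kk κ n) := by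
    filter_upwards [ht.eventually (real_asymp2 ε l lam hε hl0 (by rw [hlam]; nlinarith)),
      eventually_ge_atTop 2, ht.eventually (eventually_ge_atTop 4),
      ht.eventually (eventually_ge_atTop (6 / (lam * l) ^ 2))] with n h1 n2 h4 h6
    have hn0 : (0 : ℝ) < n := by positivity
    have hp := hpow n (by omega)
    set y := Real.log n / l with hy
    have hyl : Real.log n = y * l := by rw [hy]; field_simp
    set k := kk κ n with hk
    have hky : (k : ℝ) ≤ κ * y := Nat.floor_le (by positivity)
    have hky2 : κ * y < k + 1 := Nat.lt_floor_add_one _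
    have hk2 : 2 ≤ k := by
      apply Nat.le_floor
      push_cast
      nlinarith
    have hky3 : (k : ℝ) ≤ y := by nlinarith
    have hexp : Real.exp (-(lam * l * y)) ≤ 1 := by
      rw [Real.exp_le_one_iff]
      have : 0 ≤ lam * l * y := by positivity
      linarith
    refine ⟨n2, hk2, ?_, ?_⟩
    · have hq : (lam * l * y) ^ 2 / 2 ≤ Real.exp (lam * l * y) := by
        have h0 : 0 ≤ lam * l * y := by positivity
        have := Real.quadratic_le_exp_of_nonneg h0
        linarith
      have h3 : 3 * y ≤ Real.exp (lam * l * y) := by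
        rw [div_le_iff₀ (by positivity)] at h6
        refine le_trans ?_ hq
        nlinarith
      have h5 : 3 * y * Real.exp (-(lam * l * y)) ≤ 1 := by
        rw [Real.exp_neg, ← div_eq_mul_inv, div_le_one (Real.exp_pos _)]
        exact h3
      have : (3 : ℝ) * k * 2 ^ k ≤ 2 * (n + 1) := by
        calc (3 : ℝ) * k * 2 ^ k ≤ 3 * y * (n * Real.exp (-(lam * l * y))) := by gcongr
          _ = n * (3 * y * Real.exp (-(lam * l * y))) := by ring
          _ ≤ n * 1 := by gcongr
          _ ≤ _ := by linarith
      exact_mod_cast this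
    · have hD := D_pos k n
      rw [← Real.exp_log hD]
      simp only [hδ]
      rw [Real.exp_le_exp, hl4]
      have c1 : 0 ≤ 1 / (2 * l) - ε := by
        rw [sub_nonneg, le_div_iff₀ (by positivity)]
        nlinarith
      have c2 : Real.log ((n + 2 ^ k : ℕ) : ℝ) ≤ (y + 1) * l := by
        have : ((n + 2 ^ k : ℕ) : ℝ) ≤ n * 2 := by
          push_cast
          have : (n : ℝ) * Real.exp (-(lam * l * y)) ≤ n * 1 := by gcongr
          linarith
        have hpos : (0 : ℝ) < ((n + 2 ^ k : ℕ) : ℝ) := by positivity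
        have := Real.log_le_log hpos this
        rw [Real.log_mul hn0.ne' (by norm_num), hyl] at this
        linarith
      have c3 : 0 ≤ Real.log ((n + 2 ^ k : ℕ) : ℝ) := Real.log_natCast_nonneg _
      have c4 : (1 / (2 * l) - ε) * (Real.log ((n + 2 ^ k : ℕ) : ℝ)) ^ 2 ≤
          (1 / (2 * l) - ε) * ((y + 1) * l) ^ 2 := by gcongr
      have c5 : (1 / (2 * l) - ε) * ((y + 1) * l) ^ 2 = (l / 2 - ε * l ^ 2) * (y + 1) ^ 2 := by
        field_simp
      have d1 := log_D k n (by omega)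
      have d2 : y * l ≤ Real.log ((n : ℝ) + 1) := by
        rw [← hyl]; exact Real.log_le_log hn0 (by linarith)
      have hk1 : (1 : ℝ) ≤ k := by exact_mod_cast (by omega : 1 ≤ k)
      have d3 : k * Real.log k ≤ y * Real.log y := by
        have : Real.log k ≤ Real.log y := Real.log_le_log (by linarith) hky3
        have : 0 ≤ Real.log k := Real.log_nonneg hk1
        gcongr
      have d4 : (k : ℝ) ^ 2 / 2 * l ≤ (κ * y) ^ 2 / 2 * l := by gcongr
      have d5 : (κ * y) * (y * l) ≤ ((k : ℝ) + 1) * Real.log ((n : ℝ) + 1) := by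
        have : 0 ≤ y * l := by positivity
        gcongr
      have d6 : (κ * y) ^ 2 / 2 * l - (κ * y) * (y * l) = - (l / 2 * y ^ 2) + l * lam ^ 2 / 2 * y ^ 2 := by
        rw [hκ]; ring
      have d7 : 0 ≤ ε * l ^ 2 * (2 * y + 1) := by positivity
      have d8 : (l / 2 - ε * l ^ 2) * (y + 1) ^ 2 = l / 2 * y ^ 2 + l / 2 * (2 * y + 1) -
          ε * l ^ 2 * y ^ 2 - ε * l ^ 2 * (2 * y + 1) := by ring
      rw [neg_mul]
      rw [c5, d8] at c4
      linarith only [c4, d1, d3, d4, d5, d6, d7, h1]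
  obtain ⟨N0, hN0⟩ := eventually_atTop.1 key
  have h5 : ∀ η : ℝ, 0 < η → ∃ N, ∀ n, N ≤ n → (2 : ℝ) ^ kk κ n ≤ η * n := by
    intro η hη
    have t1 : Tendsto (fun n : ℕ => Real.exp (-(lam * l * (Real.log n / l)))) atTop (nhds 0) :=
      Real.tendsto_exp_neg_atTop_nhds_zero.comp (ht.const_mul_atTop (by positivity : 0 < lam * l))
    obtain ⟨N, hN⟩ := eventually_atTop.1 ((t1.eventually (ge_mem_nhds hη)).and (eventually_ge_atTop 1))
    refine ⟨N, fun n hn => (hpow n (hN n hn).2).trans ?_⟩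
    rw [mul_comm]
    exact mul_le_mul_of_nonneg_right (hN n hn).1 (Nat.cast_nonneg _)
  apply upper_of_null δ (max N0 2)
  intro n hn
  exact b_null δ (kk κ) (max N0 2) (by omega) (kk_mono κ (by linarith))
    (fun n hn => (hN0 n (by omega)).2.1) (fun n hn => (hN0 n (by omega)).2.2.1)
    (fun n hn => (hN0 n (by omega)).2.2.2) h5 n hn

lemma upper_part : ∀ᵐ τ : ℝ, ∀ i : ℕ, ∃ᶠ n : ℕ in atTop,
    |τ - gSigma τ n| ≤ Real.exp (-(1 / Real.log 4 - 1 / ((i : ℝ) + 2)) * (Real.log n) ^ 2) := by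
  rw [ae_all_iff]
  intro i
  apply upper_eps _ (by positivity)
  apply one_div_le_one_div_of_le (by norm_num)
  linarith [(Nat.cast_nonneg i : (0 : ℝ) ≤ i)]

end Greedy

/-- Theorem 3 of the paper: for Lebesgue-almost every `τ ∈ ℝ`,
`liminf_{n→∞} log|τ - σ_n(τ)| / (log n)^2 = -1/log 4`. -/
theorem stmt_14 :
    ∀ᵐ τ : ℝ ∂(volume : Measure ℝ),
      liminf (fun n : ℕ => Real.log |τ - gSigma τ n| / (Real.log n) ^ 2) atTop
        = -(1 / Real.log 4) := by
  filter_upwards [Greedy.lower_part, Greedy.upper_part] with τ hlow hup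
  set f : ℕ → ℝ := fun n : ℕ => Real.log |τ - gSigma τ n| / (Real.log n) ^ 2 with hf
  have h1 : ∀ i : ℕ, ∀ᶠ n in atTop, -(1 / Real.log 4) - 1 / ((i : ℝ) + 1) ≤ f n := by
    intro i
    filter_upwards [hlow i, eventually_ge_atTop 2] with n hn n2
    have hl : 0 < Real.log n := Real.log_pos (by exact_mod_cast n2)
    simp only [hf]
    rw [le_div_iff₀ (by positivity)]
    have := Real.log_le_log (Real.exp_pos _) hn
    rw [Real.log_exp] at this
    linarith
  have h2 : ∀ i : ℕ, ∃ᶠ n in atTop, f n ≤ -(1 / Real.log 4) + 1 / ((i : ℝ) + 2) := by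
    intro i
    refine ((hup i).and_eventually ((hlow 0).and (eventually_ge_atTop 2))).mono ?_
    rintro n ⟨hn, hpos, n2⟩
    have hl : 0 < Real.log n := Real.log_pos (by exact_mod_cast n2)
    simp only [hf]
    rw [div_le_iff₀ (by positivity)]
    have := Real.log_le_log (lt_of_lt_of_le (Real.exp_pos _) hpos) hn
    rw [Real.log_exp] at this
    linarith
  have hb : IsBoundedUnder (· ≥ ·) atTop f := ⟨_, eventually_map.2 (h1 0)⟩
  have hcb : IsCoboundedUnder (· ≥ ·) atTop f := IsCoboundedUnder.of_frequently_le (h2 0)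
  apply le_antisymm
  · have : ∀ i : ℕ, liminf f atTop ≤ -(1 / Real.log 4) + 1 / ((i : ℝ) + 2) := fun i =>
      liminf_le_of_frequently_le (h2 i) hb
    refine le_of_forall_pos_le_add fun e he => ?_
    obtain ⟨i, hi⟩ := exists_nat_one_div_lt he
    refine (this i).trans ?_
    have : 1 / ((i : ℝ) + 2) ≤ 1 / ((i : ℝ) + 1) := by
      apply one_div_le_one_div_of_le (by positivity); linarith
    linarith
  · refine le_of_forall_pos_le_add fun e he => ?_
    obtain ⟨i, hi⟩ := exists_nat_one_div_lt he
    have := le_liminf_of_le hcb (h1 i)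
    linarith
end
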